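/- arXiv:2409.20275 — 4 statements merged into one kernel-verified Lean document; each statement's English description precedes it below -/
import Mathlib

section
/- Let A be a real n×n matrix and c a real 1×n row vector with (A,c) observable, and let k ∈ {1,…,n}. Suppose there exists ε ∈ {−1,+1} such that for every integer N ≥ k, every r ∈ {1,…,k}, every t ∈ {1,…,N−k+1}, and every β = {1,…,k−r̄} ∪ {t̄,…,t̄+r̄−1} with r̄ ∈ {1,…,k} and t̄ ∈ {k−r̄+1,…,n−r̄+1}, one has ε·det((O_N)_{α,β}) > 0 with α = {1,…,k−r} ∪ {k−r+t,…,k+t−1}, except that for the fully consecutive column sets β = {t̄,…,t̄+k−1} with t̄ ∈ {k+1,…,n−k+1} it suffices that ε·det((O_N)_{α,β}) ≥ 0 for all such (r,t) provided ε·det((O_N)_{α,β}) > 0 whenever t ∈ {1,…,k}. Then the observability operator O of (A,c) is (k−1)-variation bounding. -/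
open Matrix Polynomial Filter

noncomputable def signChanges (l : List ℝ) : ℕ :=
  (l.zip l.tail).countP (fun p => decide (p.1 * p.2 < 0))

/-- Variation `V(u)`: number of sign changes after deleting zero entries, `-1` for the
zero vector. -/
noncomputable def variation {m : ℕ} (u : Fin m → ℝ) : ℤ :=
  if ((List.ofFn u).filter fun x => decide (x ≠ 0)) = [] then -1
  else (signChanges ((List.ofFn u).filter fun x => decide (x ≠ 0)) : ℤ)

/-- Maximal variation `V_z(u)`: largest number of sign changes obtainable by replacing every
zero entry of `u` by an arbitrary nonzero real number. -/
noncomputable def maxVariation {m : ℕ} (u : Fin m → ℝ) : ℤ :=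
  sSup {v : ℤ | ∃ w : Fin m → ℝ, (∀ i, w i ≠ 0) ∧ (∀ i, u i ≠ 0 → w i = u i) ∧
    v = (signChanges (List.ofFn w) : ℤ)}

/-- `X` is strictly `k`-variation bounding. -/
def SVB {n m : ℕ} (X : Matrix (Fin n) (Fin m) ℝ) (k : ℕ) : Prop :=
  ∀ u : Fin m → ℝ, u ≠ 0 → variation u ≤ (k : ℤ) → maxVariation (X.mulVec u) ≤ (k : ℤ)

/-- `X` is `k`-variation bounding. -/
def VB {n m : ℕ} (X : Matrix (Fin n) (Fin m) ℝ) (k : ℕ) : Prop :=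
  ∀ u : Fin m → ℝ, u ≠ 0 → variation u ≤ (k : ℤ) → variation (X.mulVec u) ≤ (k : ℤ)

/-- `X` is `k`-variation diminishing. -/
def VD {n m : ℕ} (X : Matrix (Fin n) (Fin m) ℝ) (k : ℕ) : Prop :=
  ∀ j : ℕ, j ≤ k → VB X j

/-- `X` is strictly `k`-sign consistent: all `k×k` minors strictly positive, or all strictly
negative. -/
def SSC {n m : ℕ} (X : Matrix (Fin n) (Fin m) ℝ) (k : ℕ) : Prop :=
  (∀ (f : Fin k → Fin n) (g : Fin k → Fin m), StrictMono f → StrictMono g →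
    0 < (X.submatrix f g).det) ∨
  (∀ (f : Fin k → Fin n) (g : Fin k → Fin m), StrictMono f → StrictMono g →
    (X.submatrix f g).det < 0)

/-- `X` is `k`-sign consistent: all `k×k` minors nonnegative, or all nonpositive. -/
def SC {n m : ℕ} (X : Matrix (Fin n) (Fin m) ℝ) (k : ℕ) : Prop :=
  (∀ (f : Fin k → Fin n) (g : Fin k → Fin m), StrictMono f → StrictMono g →
    0 ≤ (X.submatrix f g).det) ∨
  (∀ (f : Fin k → Fin n) (g : Fin k → Fin m), StrictMono f → StrictMono g →
    (X.submatrix f g).det ≤ 0)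

/-- `X` is `k`-sign regular. -/
def SR {n m : ℕ} (X : Matrix (Fin n) (Fin m) ℝ) (k : ℕ) : Prop :=
  ∀ j : ℕ, 1 ≤ j → j ≤ k → SC X j

/-- `X` is strictly totally positive. -/
def STP {n m : ℕ} (X : Matrix (Fin n) (Fin m) ℝ) : Prop :=
  ∀ (j : ℕ) (f : Fin j → Fin n) (g : Fin j → Fin m), StrictMono f → StrictMono g →
    0 < (X.submatrix f g).det

/-- `X` is `k`-positive: all `j×j` minors nonnegative for `j = 1, …, k`. -/
def KPos {n m : ℕ} (X : Matrix (Fin n) (Fin m) ℝ) (k : ℕ) : Prop :=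
  ∀ j : ℕ, 1 ≤ j → j ≤ k → ∀ (f : Fin j → Fin n) (g : Fin j → Fin m),
    StrictMono f → StrictMono g → 0 ≤ (X.submatrix f g).det

/-- `X` is strictly `k`-positive: all `j×j` minors positive for `j = 1, …, k`. -/
def KPosStrict {n m : ℕ} (X : Matrix (Fin n) (Fin m) ℝ) (k : ℕ) : Prop :=
  ∀ j : ℕ, 1 ≤ j → j ≤ k → ∀ (f : Fin j → Fin n) (g : Fin j → Fin m),
    StrictMono f → StrictMono g → 0 < (X.submatrix f g).det

/-- The `t`-step observability matrix `O_t` with `i`-th row `c Aⁱ⁻¹`. -/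
noncomputable def obsMat {n : ℕ} (A : Matrix (Fin n) (Fin n) ℝ) (c : Fin n → ℝ) (t : ℕ) :
    Matrix (Fin t) (Fin n) ℝ :=
  Matrix.of fun i j => Matrix.vecMul c (A ^ (i : ℕ)) j

/-- The pair `(A, c)` is observable. -/
def Observable {n : ℕ} (A : Matrix (Fin n) (Fin n) ℝ) (c : Fin n → ℝ) : Prop :=
  (obsMat A c n).det ≠ 0

/-- The observability operator of `(A, c)` is strictly `k`-variation bounding. -/
def ObsSVB {n : ℕ} (A : Matrix (Fin n) (Fin n) ℝ) (c : Fin n → ℝ) (k : ℕ) : Prop :=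
  ∀ t : ℕ, 0 < t → SVB (obsMat A c t) k

/-- The observability operator of `(A, c)` is `k`-variation bounding. -/
def ObsVB {n : ℕ} (A : Matrix (Fin n) (Fin n) ℝ) (c : Fin n → ℝ) (k : ℕ) : Prop :=
  ∀ t : ℕ, 0 < t → VB (obsMat A c t) k

/-- The matrix `M_r[t]`: first `n - r` rows `c, cA, …, cA^{n-r-1}`, last `r` rows
`cA^{n-r+t-1}, …, cA^{n+t-2}`. -/
noncomputable def Mrt {n : ℕ} (A : Matrix (Fin n) (Fin n) ℝ) (c : Fin n → ℝ) (r t : ℕ) :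
    Matrix (Fin n) (Fin n) ℝ :=
  Matrix.of fun i j =>
    Matrix.vecMul c (A ^ (if (i : ℕ) < n - r then (i : ℕ) else (i : ℕ) + t - 1)) j

theorem mul_neg_of_mul_pos {x y z : ℝ} (hxy : 0 < x * y) (hxz : x * z < 0) : y * z < 0 := by
  rcases pos_and_pos_or_neg_and_neg_of_mul_pos hxy with ⟨hx, hy⟩ | ⟨hx, hy⟩
  · exact mul_neg_of_pos_of_neg hy (by nlinarith)
  · exact mul_neg_of_neg_of_pos hy (by nlinarith)

theorem isChain_cons_of_mul_pos {x y : ℝ} (hxy : 0 < x * y) {s : List ℝ}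
    (h : (x :: s).IsChain fun a b => a * b < 0) : (y :: s).IsChain fun a b => a * b < 0 := by
  cases s with
  | nil => simp
  | cons z s =>
    rw [List.isChain_cons_cons] at h ⊢
    exact ⟨mul_neg_of_mul_pos hxy h.1, h.2⟩

theorem signChanges_cons_cons (x y : ℝ) (l : List ℝ) :
    signChanges (x :: y :: l) = signChanges (y :: l) + if x * y < 0 then 1 else 0 := by
  simp [signChanges, List.countP_cons]

theorem mul_pos_of_not_neg {x y : ℝ} (hx : x ≠ 0) (hy : y ≠ 0) (h : ¬ x * y < 0) : 0 < x * y :=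
  lt_of_le_of_ne (not_lt.1 h) (mul_ne_zero hx hy).symm

theorem length_le_signChanges_cons {l : List ℝ} {x : ℝ} {s : List ℝ} (hx : x ≠ 0)
    (hl : ∀ y ∈ l, y ≠ 0) (hc : (x :: s).IsChain fun a b => a * b < 0) (hs : s.Sublist l) :
    s.length ≤ signChanges (x :: l) := by
  induction l generalizing x s with
  | nil => simp_all
  | cons y l ih =>
    have hy : y ≠ 0 := hl y (by simp)
    have hl' : ∀ z ∈ l, z ≠ 0 := fun z hz => hl z (by simp [hz])
    rw [signChanges_cons_cons]
    rcases List.sublist_cons_iff.1 hs with hs | ⟨s', rfl, hs'⟩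
    · split_ifs with hxy
      · cases s with
        | nil => simp
        | cons z s =>
          rw [List.isChain_cons_cons] at hc
          have hz : z ≠ 0 := hl' z (hs.subset (by simp))
          have hzy : 0 < z * y := by
            refine mul_pos_of_not_neg hz hy fun h => ?_
            have h1 := hc.1
            have h2 : 0 < (x * z) * (x * y) := mul_pos_of_neg_of_neg h1 hxy
            nlinarith [mul_nonneg (sq_nonneg x) (neg_nonneg.2 h.le)]
          have := ih hy hl' (isChain_cons_of_mul_pos hzy hc.2) (List.sublist_of_cons_sublist hs)
          simpa using this
      · exact ih hy hl' (isChain_cons_of_mul_pos (mul_pos_of_not_neg hx hy hxy) hc) hs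
    · rw [List.isChain_cons_cons] at hc
      rw [if_pos hc.1]
      simpa using ih hy hl' hc.2 hs'

theorem length_le_signChanges_add_one {l s : List ℝ} (hl : ∀ y ∈ l, y ≠ 0)
    (hc : s.IsChain fun a b => a * b < 0) (hs : s.Sublist l) :
    s.length ≤ signChanges l + 1 := by
  cases s with
  | nil => simp
  | cons z s =>
    cases l with
    | nil => simp at hs
    | cons x l =>
      have hx : x ≠ 0 := hl x (by simp)
      have hl' : ∀ y ∈ l, y ≠ 0 := fun y hy => hl y (by simp [hy])
      rcases List.sublist_cons_iff.1 hs with hs | ⟨s', h, hs⟩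
      · by_cases hxz : x * z < 0
        · exact (length_le_signChanges_cons hx hl' (List.isChain_cons_cons.2 ⟨hxz, hc⟩) hs).trans
            (Nat.le_succ _)
        · have hz : z ≠ 0 := hl' z (hs.subset (by simp))
          have := mul_pos_of_not_neg hx hz hxz
          rw [mul_comm] at this
          simpa using length_le_signChanges_cons hx hl' (isChain_cons_of_mul_pos this hc)
            (List.sublist_of_cons_sublist hs)
      · obtain ⟨rfl, rfl⟩ := List.cons.inj h
        simpa using length_le_signChanges_cons hx hl' hc hs

theorem exists_sublist_length_eq_signChanges {l : List ℝ} {x : ℝ} (hx : x ≠ 0)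
    (hl : ∀ y ∈ l, y ≠ 0) :
    ∃ s : List ℝ, s.Sublist l ∧ ((x :: s).IsChain fun a b => a * b < 0) ∧
      s.length = signChanges (x :: l) := by
  induction l generalizing x with
  | nil => exact ⟨[], by simp [signChanges]⟩
  | cons y l ih =>
    have hy : y ≠ 0 := hl y (by simp)
    obtain ⟨s, hs, hc, hlen⟩ := ih hy fun z hz => hl z (by simp [hz])
    rw [signChanges_cons_cons]
    split_ifs with hxy
    · exact ⟨y :: s, hs.cons_cons y, List.isChain_cons_cons.2 ⟨hxy, hc⟩, by simp [hlen]⟩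
    · have := mul_pos_of_not_neg hx hy hxy
      rw [mul_comm] at this
      exact ⟨s, hs.cons y, isChain_cons_of_mul_pos this hc, by simp [hlen]⟩

/-- The sequence `u` alternates in sign along some `k + 1` increasing indices. -/
def Alternates {ι : Type*} [Preorder ι] (u : ι → ℝ) (k : ℕ) : Prop :=
  ∃ a : Fin (k + 1) → ι, StrictMono a ∧ ∀ i : Fin k, u (a i.castSucc) * u (a i.succ) < 0

theorem sublist_ofFn_of_strictMono {α : Type*} {m k : ℕ} (u : Fin m → α) {a : Fin k → Fin m}
    (ha : StrictMono a) : (List.ofFn fun i => u (a i)).Sublist (List.ofFn u) := by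
  rw [List.sublist_iff_exists_fin_orderEmbedding_get_eq]
  refine ⟨OrderEmbedding.ofStrictMono
    (fun i => Fin.cast (by simp) (a (Fin.cast (by simp) i))) fun i j hij => ha hij, fun i => ?_⟩
  simp only [List.get_eq_getElem, List.getElem_ofFn]
  rfl

theorem le_variation_of_alternates {m k : ℕ} (hk : 1 ≤ k) {u : Fin m → ℝ}
    (h : Alternates u k) : (k : ℤ) ≤ variation u := by
  obtain ⟨a, ha, hu⟩ := h
  have hne : ∀ i, u (a i) ≠ 0 := by
    intro i h0
    obtain ⟨k, rfl⟩ := Nat.exists_eq_add_of_le' hk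
    induction i using Fin.cases with
    | zero => simpa [h0] using hu 0
    | succ i => simpa [h0] using hu i
  set s := List.ofFn fun i => u (a i) with hs_def
  have hs : s.Sublist (List.ofFn u) := sublist_ofFn_of_strictMono u ha
  have hc : s.IsChain fun a b => a * b < 0 := by
    rw [hs_def, List.isChain_ofFn]
    intro i hi
    exact hu ⟨i, by omega⟩
  have hs' := hs.filter fun x => decide (x ≠ 0)
  rw [List.filter_eq_self.2
    (by simpa [hs_def, List.forall_mem_ofFn_iff, -List.ofFn_succ] using hne)] at hs'
  have hlen := length_le_signChanges_add_one (by simp) hc hs'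
  have hsl : s.length = k + 1 := by simp [hs_def]
  unfold variation
  rw [if_neg]
  · omega
  · intro h
    rw [h] at hs'
    simp [List.sublist_nil.1 hs'] at hsl

theorem alternates_of_le_variation {m k : ℕ} {u : Fin m → ℝ} (h : (k : ℤ) ≤ variation u) :
    Alternates u k := by
  unfold variation at h
  split_ifs at h with h0
  · omega
  · obtain ⟨x, l, hxl⟩ := List.exists_cons_of_ne_nil h0
    have hne : ∀ y ∈ x :: l, y ≠ 0 := by
      intro y hy
      rw [← hxl] at hy
      simpa using (List.mem_filter.1 hy).2
    obtain ⟨s, hs, hc, hlen⟩ := exists_sublist_length_eq_signChanges (hne x (by simp))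
      (fun y (hy : y ∈ l) => hne y (by simp [hy]))
    rw [hxl] at h
    have hs' : (x :: s).Sublist (List.ofFn u) :=
      (hs.cons_cons x).trans (hxl ▸ List.filter_sublist)
    obtain ⟨f, hf⟩ := List.sublist_iff_exists_fin_orderEmbedding_get_eq.1 hs'
    have hk : k + 1 ≤ (x :: s).length := by
      simp only [List.length_cons]
      omega
    refine ⟨fun i => Fin.cast (by simp) (f (Fin.castLE hk i)), fun i j hij => ?_, fun i => ?_⟩
    · exact f.strictMono (show Fin.castLE hk i < Fin.castLE hk j from hij)
    · have key : ∀ j : Fin (k + 1), u (Fin.cast (by simp) (f (Fin.castLE hk j))) =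
          (x :: s)[(j : ℕ)] := by
        intro j
        have := hf (Fin.castLE hk j)
        simp only [List.get_eq_getElem, List.getElem_ofFn] at this
        exact this.symm
      simp only [key]
      exact (List.isChain_iff_getElem.1 hc) i (by have := i.2; simp at hk ⊢; omega)

/-- The abstract properties of Plücker coordinates used below: antisymmetry and the three-term
relations. -/
structure IsPlucker {k : ℕ} (F : (Fin k → ℕ) → ℝ) : Prop where
  perm : ∀ (f : Fin k → ℕ) (σ : Equiv.Perm (Fin k)),
    F (f ∘ σ) = ((Equiv.Perm.sign σ : ℤ) : ℝ) * F f
  three_term : ∀ (f : Fin k → ℕ) (i j : Fin k), i ≠ j → ∀ a b c d : ℕ,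
    F (Function.update (Function.update f i a) j c) *
        F (Function.update (Function.update f i b) j d) =
      F (Function.update (Function.update f i a) j b) *
          F (Function.update (Function.update f i c) j d) +
        F (Function.update (Function.update f i a) j d) *
          F (Function.update (Function.update f i b) j c)

theorem det_three_term {k : ℕ} (W : Fin k → Fin k → ℝ) {i j : Fin k} (hij : i ≠ j)
    (a b c d : Fin k → ℝ) :
    (Matrix.of (Function.update (Function.update W i a) j c)).det *
        (Matrix.of (Function.update (Function.update W i b) j d)).det =
      (Matrix.of (Function.update (Function.update W i a) j b)).det *
          (Matrix.of (Function.update (Function.update W i c) j d)).det +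
        (Matrix.of (Function.update (Function.update W i a) j d)).det *
          (Matrix.of (Function.update (Function.update W i b) j c)).det := by
  set B : Matrix (Fin k) (Fin k) ℝ :=
    Matrix.of (Function.update (Function.update W i b) j d) with hB
  set φ : (Fin k → ℝ) →ₗ[ℝ] ℝ :=
    (Matrix.detRowAlternating (R := ℝ) (n := Fin k)).toMultilinearMap.toLinearMap
      (Function.update W i a) j with hφ
  have hφ' : ∀ x, φ x = (Matrix.of (Function.update (Function.update W i a) j x)).det :=
    fun x => rfl
  have hcramer : ∑ l, (B.updateRow l c).det • B l = B.det • c := by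
    have h := Matrix.mulVec_cramer Bᵀ c
    rw [Matrix.det_transpose] at h
    rw [← h]
    ext m
    simp [Matrix.mulVec, dotProduct, Matrix.cramer_transpose_apply, mul_comm]
  have h := congrArg φ hcramer
  rw [map_sum, map_smul, ← Finset.add_sum_erase _ _ (Finset.mem_univ i),
    ← Finset.add_sum_erase _ _ (Finset.mem_erase.2 ⟨hij.symm, Finset.mem_univ j⟩),
    Finset.sum_eq_zero] at h
  · have hBi : B i = b := by
      change Function.update (Function.update W i b) j d i = b
      rw [Function.update_of_ne hij, Function.update_self]
    have hBj : B j = d := Function.update_self ..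
    have hc1 : B.updateRow i c =
        Matrix.of (Function.update (Function.update W i c) j d) := by
      rw [hB]
      change Function.update (Function.update (Function.update W i b) j d) i c = _
      rw [Function.update_comm hij.symm, Function.update_idem]
      rfl
    have hc2 : B.updateRow j c =
        Matrix.of (Function.update (Function.update W i b) j c) := by
      rw [hB]
      change Function.update (Function.update (Function.update W i b) j d) j c = _
      rw [Function.update_idem]
      rfl
    rw [map_smul, map_smul] at h
    simp only [smul_eq_mul, hBi, hBj, hc1, hc2, hφ'] at h
    linarith
  · intro l hl
    simp only [Finset.mem_erase, Finset.mem_univ, and_true] at hl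
    rw [map_smul, smul_eq_mul]
    rw [hφ']
    have : B l = W l := by
      change Function.update (Function.update W i b) j d l = W l
      rw [Function.update_of_ne hl.1, Function.update_of_ne hl.2]
    rw [this, Matrix.det_zero_of_row_eq (i := l) (j := j)
      (M := Matrix.of (Function.update (Function.update W i a) j (W l))) hl.1, mul_zero]
    ext m
    simp [hl.1, hl.2]

theorem isPlucker_det {k : ℕ} (ε : ℝ) (v : ℕ → Fin k → ℝ) :
    IsPlucker fun f : Fin k → ℕ => ε * (Matrix.of fun i => v (f i)).det where
  perm f σ := by
    have := Matrix.det_permute σ (Matrix.of fun i => v (f i))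
    simp only [Function.comp_apply]
    rw [mul_left_comm, ← this]
    rfl
  three_term f i j hij a b c d := by
    have key : ∀ x y, (fun l => v (Function.update (Function.update f i x) j y l)) =
        Function.update (Function.update (fun l => v (f l)) i (v x)) j (v y) := by
      intro x y
      funext l
      by_cases hj : l = j
      · subst hj; simp
      · by_cases hi : l = i
        · subst hi; simp [hj]
        · simp [hi, hj]
    have := det_three_term (fun l => v (f l)) hij (v a) (v b) (v c) (v d)
    simp only [key]
    linear_combination ε ^ 2 * this

namespace IsPlucker

theorem insertNth {m : ℕ} {F : (Fin (m + 1) → ℕ) → ℝ} (hF : IsPlucker F) (p : Fin (m + 1))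
    (x : ℕ) (J : Fin m → ℕ) :
    F (Fin.insertNth p x J) = (-1) ^ (p : ℕ) * F (Fin.cons x J) := by
  have h : (Fin.insertNth p x J : Fin (m + 1) → ℕ) = Fin.cons x J ∘ p.cycleRange := by
    funext i
    obtain ⟨j, rfl⟩ := p.cycleRange.symm.surjective i
    refine Fin.cases ?_ (fun j => ?_) j <;> simp
  rw [h, hF.perm]
  simp

theorem cons {m : ℕ} {F : (Fin (m + 1) → ℕ) → ℝ} (hF : IsPlucker F) :
    IsPlucker fun g : Fin m → ℕ => F (Fin.cons 0 fun i => g i + 1) where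
  perm f σ := by
    have h : (Fin.cons 0 fun i => (f ∘ σ) i + 1 : Fin (m + 1) → ℕ) =
        (Fin.cons 0 fun i => f i + 1) ∘ Equiv.Perm.decomposeFin.symm (0, σ) := by
      funext i
      refine Fin.cases ?_ (fun i => ?_) i <;> simp
    rw [h, hF.perm]
    simp
  three_term f i j hij a b c d := by
    have key : ∀ x y,
        (Fin.cons 0 fun l => Function.update (Function.update f i x) j y l + 1 :
          Fin (m + 1) → ℕ) =
        Function.update (Function.update (Fin.cons 0 fun l => f l + 1 : Fin (m + 1) → ℕ)
          i.succ (x + 1)) j.succ (y + 1) := by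
      intro x y
      rw [← Fin.cons_update, ← Fin.cons_update]
      congr 1
      funext l
      by_cases hj : l = j
      · subst hj; simp
      · by_cases hi : l = i
        · subst hi; simp [hj]
        · simp [hi, hj]
    simp only [key]
    exact hF.three_term _ _ _ (by simpa using hij) _ _ _ _

/-- The three-term relation with all index tuples in increasing order. -/
theorem three_term_sorted {m : ℕ} {F : (Fin (m + 2) → ℕ) → ℝ} (hF : IsPlucker F)
    (a b c d : ℕ) (J : Fin m → ℕ) (p : Fin (m + 1)) :
    F (Fin.cons a (Fin.insertNth p c J)) * F (Fin.cons b (Fin.snoc J d)) =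
      F (Fin.cons a (Fin.cons b J)) * F (Fin.snoc (Fin.insertNth p c J : Fin (m + 1) → ℕ) d) +
        F (Fin.cons a (Fin.snoc J d)) * F (Fin.cons b (Fin.insertNth p c J)) := by
  have hswap : ∀ x y, F (Fin.cons x (Fin.cons y J)) = -F (Fin.cons y (Fin.cons x J)) := by
    intro x y
    have h0 := hF.insertNth (Fin.succ 0) y (Fin.cons x J)
    rw [Fin.insertNth_succ_cons, Fin.insertNth_zero'] at h0
    simpa using h0
  have h1 : ∀ (x y) (p : Fin (m + 1)), F (Fin.cons x (Fin.insertNth p y J)) =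
      (-1) ^ (p : ℕ) * F (Fin.cons x (Fin.cons y J)) := by
    intro x y p
    rw [← Fin.insertNth_succ_cons, hF.insertNth, hswap x]
    simp [pow_succ]
  have h2 : ∀ x y, F (Fin.cons x (Fin.snoc J y)) =
      (-1) ^ m * F (Fin.cons x (Fin.cons y J)) := by
    intro x y
    rw [← Fin.insertNth_last', h1]
    simp
  have h3 : F (Fin.snoc (Fin.insertNth p c J : Fin (m + 1) → ℕ) d) =
      (-1) ^ (m + p : ℕ) * F (Fin.cons c (Fin.cons d J)) := by
    rw [← Fin.insertNth_last', hF.insertNth, h1, hswap c]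
    simp [pow_succ, pow_add, mul_assoc]
  have h := hF.three_term (Fin.cons 0 (Fin.cons 0 J)) 0 1 (by simp) a b c d
  have key : ∀ x y, Function.update (Function.update
      (Fin.cons 0 (Fin.cons 0 J) : Fin (m + 2) → ℕ) 0 x) 1 y = Fin.cons x (Fin.cons y J) := by
    intro x y
    funext i
    refine Fin.cases ?_ (fun i => Fin.cases ?_ (fun i => ?_) i) i
    · simp
    · simp
    · rw [Function.update_of_ne (by simp [Fin.ext_iff]), Function.update_of_ne (by simp)]
      simp
  simp only [key] at h
  rw [h1, h1, h2, h2, h3, pow_add]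
  linear_combination (-1) ^ m * (-1) ^ (p : ℕ) * h

end IsPlucker

theorem StrictMono.exists_gap {m : ℕ} {f : Fin (m + 2) → ℕ} (hf : StrictMono f)
    (h : ∃ i, f i ≠ i + f 0) : ∃ i : Fin (m + 1), f i.castSucc + 1 < f i.succ := by
  by_contra! hgap
  obtain ⟨i, hi⟩ := h
  refine hi ?_
  clear hi
  induction i using Fin.induction with
  | zero => simp
  | succ i ih =>
    have h1 := hgap i
    have h2 := hf (Fin.castSucc_lt_succ (i := i))
    simp only [Fin.val_succ, Fin.val_castSucc] at ih ⊢
    omega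

theorem strictMono_snoc_iff {m : ℕ} {J : Fin m → ℕ} {d : ℕ} :
    StrictMono (Fin.snoc J d : Fin (m + 1) → ℕ) ↔ StrictMono J ∧ ∀ i, J i < d := by
  rw [← Fin.insertNth_last', Fin.strictMono_insertNth_iff]
  refine and_congr_right fun _ => ⟨fun h i => h.1 i (Fin.castSucc_lt_last i),
    fun h => ⟨fun i _ => h i, fun i hi => ?_⟩⟩
  exact absurd (Fin.castSucc_lt_last i) (not_lt.2 hi)

theorem IsPlucker.of_consecutive {m : ℕ} {F : (Fin (m + 2) → ℕ) → ℝ} (hF : IsPlucker F) (N : ℕ)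
    {Q : ℝ → Prop} (hpos : ∀ x, 0 < x → Q x)
    (hcomb : ∀ p q r x y z, 0 < p → 0 < q → 0 < r → Q x → Q y → r * z = p * x + q * y → Q z)
    (h0 : ∀ g : Fin (m + 1) → ℕ, StrictMono g → (∀ i, 0 < g i) → (∀ i, g i < N) →
      0 < F (Fin.cons 0 g))
    (hcons : ∀ s, m + 1 + s < N → Q (F fun i => (i : ℕ) + s))
    {f : Fin (m + 2) → ℕ} (hf : StrictMono f) (hN : ∀ i, f i < N) : Q (F f) := by
  induction hspan : f (Fin.last _) - f 0 using Nat.strong_induction_on generalizing f with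
  | _ span ih =>
    subst hspan
    rcases Nat.eq_zero_or_pos (f 0) with hf0 | hf0
    · refine hpos _ ?_
      rw [← Fin.cons_self_tail f, hf0]
      refine h0 _ (fun i j hij => hf (by simpa using hij)) (fun i => ?_) fun i => hN _
      exact (Nat.zero_le _).trans_lt (hf (Fin.succ_pos i))
    by_cases hex : ∃ i, f i ≠ i + f 0
    swap
    · push Not at hex
      have hlast := hN (Fin.last _)
      rw [hex] at hlast
      rw [funext hex]
      exact hcons _ hlast
    obtain ⟨p, hp⟩ := hf.exists_gap hex
    set b := f 0 with hb
    set d := f (Fin.last _) with hd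
    set J : Fin m → ℕ := fun i => f i.castSucc.succ with hJ
    set c := f p.castSucc + 1 with hc
    set K : Fin (m + 1) → ℕ := Fin.insertNth p c J with hK
    have hJmono : StrictMono J := fun i j hij => hf (by simpa using hij)
    have hbJ : ∀ i, b < J i := fun i => hf (Fin.succ_pos _)
    have hJd : ∀ i, J i < d := fun i => hf (by
      rw [Fin.succ_castSucc]; exact Fin.castSucc_lt_last _)
    have hbd : b < d := hf (Fin.last_pos)
    have hbc : b < c := Nat.lt_succ_of_le (hf.monotone (Fin.zero_le _))
    have hcd : c < d := hp.trans_le (hf.monotone (Fin.le_last _))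
    have hKmono : StrictMono K := by
      rw [hK, Fin.strictMono_insertNth_iff]
      refine ⟨hJmono, fun i hi => ?_, fun i hi => ?_⟩
      · refine Nat.lt_succ_of_le (hf.monotone ?_)
        rw [Fin.succ_castSucc]
        simpa [Fin.le_def, Fin.lt_def, Nat.succ_le_iff] using hi
      · exact hp.trans_le (hf.monotone (by simpa using hi))
    have hK_all : ∀ P : ℕ → Prop, P c → (∀ i, P (J i)) → ∀ i, P (K i) := by
      intro P h1 h2
      rw [Fin.forall_iff_succAbove p]
      simpa [hK] using ⟨h1, h2⟩
    have hbK : ∀ i, b < K i := hK_all (b < ·) hbc hbJ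
    have hKd : ∀ i, K i < d := hK_all (· < d) hcd hJd
    have hdN : d < N := hN _
    have hbJmono : StrictMono (Fin.cons b J : Fin (m + 1) → ℕ) :=
      Fin.strictMono_cons.2 ⟨hbJ, hJmono⟩
    have hJdmono : StrictMono (Fin.snoc J d : Fin (m + 1) → ℕ) :=
      strictMono_snoc_iff.2 ⟨hJmono, hJd⟩
    have hf_eq : f = Fin.cons b (Fin.snoc J d) := by
      funext i
      refine Fin.cases rfl (fun i => ?_) i
      refine Fin.lastCases ?_ (fun i => ?_) i
      · simp [hd]
      · simp [hJ]
    have hrel := hF.three_term_sorted 0 b c d J p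
    rw [← hf_eq] at hrel
    refine hcomb _ _ _ _ _ _ ?_ ?_ ?_ ?_ ?_ hrel
    · refine h0 _ hbJmono (fun i => ?_) (fun i => ?_)
      · refine Fin.cases hf0 (fun i => ?_) i
        exact hf0.trans (hbJ i)
      · refine Fin.cases (hbd.trans hdN) (fun i => ?_) i
        exact (hJd i).trans hdN
    · refine h0 _ hJdmono (fun i => ?_) (fun i => ?_)
      · refine Fin.lastCases ?_ (fun i => ?_) i
        · simpa using hf0.trans hbd
        · simpa using hf0.trans (hbJ i)
      · refine Fin.lastCases ?_ (fun i => ?_) i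
        · simpa using hdN
        · simpa using (hJd i).trans hdN
    · exact h0 _ hKmono (fun i => hf0.trans (hbK i)) fun i => (hKd i).trans hdN
    · refine ih _ ?_ (strictMono_snoc_iff.2 ⟨hKmono, hKd⟩) (fun i => ?_) rfl
      · have h1 : (Fin.snoc K d : Fin (m + 2) → ℕ) 0 = K 0 := Fin.snoc_castSucc (i := 0) ..
        rw [Fin.snoc_last, h1]
        have := hbK 0
        omega
      · refine Fin.lastCases ?_ (fun i => ?_) i
        · simpa using hdN
        · simpa using (hKd i).trans hdN
    · refine ih _ ?_ (Fin.strictMono_cons.2 ⟨hbK, hKmono⟩) (fun i => ?_) rfl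
      · have h1 : (Fin.cons b K : Fin (m + 2) → ℕ) (Fin.last _) = K (Fin.last _) :=
          Fin.cons_succ (i := Fin.last m) ..
        rw [h1, Fin.cons_zero]
        have := hKd (Fin.last _)
        omega
      · refine Fin.cases (hbd.trans hdN) (fun i => ?_) i
        exact (hKd i).trans hdN

/-- The index tuple `0, …, k - r - 1, k - r + s, …, k - 1 + s`. -/
def blockIndex (k r s : ℕ) (i : Fin k) : ℕ := if (i : ℕ) < k - r then i else i + s

theorem blockIndex_self (k s : ℕ) : blockIndex k k s = fun i : Fin k => (i : ℕ) + s := by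
  funext i
  simp [blockIndex]

theorem blockIndex_zero (k r : ℕ) : blockIndex k r 0 = fun i : Fin k => (i : ℕ) := by
  funext i
  simp [blockIndex]

theorem blockIndex_succ {m r : ℕ} (hr : r ≤ m) (s : ℕ) :
    blockIndex (m + 1) r s = Fin.cons 0 fun i => blockIndex m r s i + 1 := by
  funext i
  refine Fin.cases ?_ (fun i => ?_) i
  · simp [blockIndex, Nat.sub_pos_of_lt (Nat.lt_succ_of_le hr)]
  · simp only [blockIndex, Fin.val_succ, Fin.cons_succ]
    split_ifs <;> omega

theorem pos_cons_of_forall {m : ℕ} {F : (Fin (m + 1) → ℕ) → ℝ} {N : ℕ}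
    (h : ∀ f : Fin m → ℕ, StrictMono f → (∀ i, f i < N - 1) → 0 < F (Fin.cons 0 fun i => f i + 1))
    {g : Fin m → ℕ} (hg : StrictMono g) (hpos : ∀ i, 0 < g i) (hN : ∀ i, g i < N) :
    0 < F (Fin.cons 0 g) := by
  have := h (fun i => g i - 1)
    (fun i j hij => by have := hg hij; have := hpos i; show g i - 1 < g j - 1; omega)
    (fun i => by have := hN i; have := hpos i; omega)
  convert this using 3
  funext i
  have := hpos i
  omega

theorem IsPlucker.pos_of_blockIndex {m : ℕ} {F : (Fin (m + 1) → ℕ) → ℝ} (hF : IsPlucker F)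
    (N : ℕ) (h : ∀ r s, 1 ≤ r → r ≤ m + 1 → m + s < N → 0 < F (blockIndex (m + 1) r s))
    {f : Fin (m + 1) → ℕ} (hf : StrictMono f) (hN : ∀ i, f i < N) : 0 < F f := by
  induction m generalizing N with
  | zero =>
    have := h 1 (f 0) le_rfl le_rfl (by simpa using hN 0)
    rw [blockIndex_self] at this
    convert this using 2
    funext i
    rw [Fin.fin_one_eq_zero i]
    simp
  | succ m ih =>
    refine hF.of_consecutive N (Q := (0 < ·)) (fun _ hx => hx) ?_ ?_ ?_ hf hN
    · intro p q r x y z hp hq hr hx hy hz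
      exact pos_of_mul_pos_right (hz ▸ by positivity) hr.le
    · intro g hg
      refine pos_cons_of_forall (fun f hf hfN => ?_) hg
      refine ih hF.cons (N - 1) (fun r s hr hrm hs => ?_) hf hfN
      rw [← blockIndex_succ hrm]
      exact h _ _ hr (by omega) (by omega)
    · intro s hs
      rw [← blockIndex_self]
      exact h _ _ (by omega) le_rfl hs

theorem IsPlucker.nonneg_of_blockIndex {m : ℕ} {F : (Fin (m + 1) → ℕ) → ℝ} (hF : IsPlucker F)
    (N : ℕ) (h : ∀ r s, 1 ≤ r → r ≤ m → m + s < N → 0 < F (blockIndex (m + 1) r s))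
    (hcons : ∀ s, m + s < N → 0 ≤ F (blockIndex (m + 1) (m + 1) s))
    {f : Fin (m + 1) → ℕ} (hf : StrictMono f) (hN : ∀ i, f i < N) : 0 ≤ F f := by
  cases m with
  | zero =>
    have := hcons (f 0) (by simpa using hN 0)
    rw [blockIndex_self] at this
    convert this using 2
    funext i
    rw [Fin.fin_one_eq_zero i]
    simp
  | succ m =>
    refine hF.of_consecutive N (Q := (0 ≤ ·)) (fun _ hx => hx.le) ?_ ?_ ?_ hf hN
    · intro p q r x y z hp hq hr hx hy hz
      exact nonneg_of_mul_nonneg_right (hz ▸ by positivity) hr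
    · intro g hg
      refine pos_cons_of_forall (fun f hf hfN => ?_) hg
      refine hF.cons.pos_of_blockIndex (N - 1) (fun r s hr hrm hs => ?_) hf hfN
      rw [← blockIndex_succ hrm]
      exact h _ _ hr hrm (by omega)
    · intro s hs
      rw [← blockIndex_self]
      exact hcons _ hs

theorem StrictMono.exists_update_succ {k : ℕ} {γ β : Fin k → ℕ} (hγ : StrictMono γ)
    (hβ : StrictMono β) (hle : γ ≤ β) (hne : γ ≠ β) :
    ∃ i, γ i < β i ∧ StrictMono (Function.update γ i (γ i + 1)) := by
  classical
  have hex : (Finset.univ.filter fun i => γ i < β i).Nonempty := by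
    obtain ⟨i, hi⟩ := Function.ne_iff.1 hne
    exact ⟨i, by simpa using lt_of_le_of_ne (hle i) hi⟩
  obtain ⟨i, hi, hmax⟩ := Finset.exists_max_image _ id hex
  simp only [Finset.mem_filter, Finset.mem_univ, true_and, id] at hi hmax
  refine ⟨i, hi, fun p q hpq => ?_⟩
  have hγpq := hγ hpq
  by_cases hp : p = i
  · subst hp
    rw [Function.update_self, Function.update_of_ne hpq.ne']
    have h1 : ¬ γ q < β q := fun h => (hmax q h).not_gt hpq
    have h2 := hβ hpq
    omega
  · rw [Function.update_of_ne hp]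
    by_cases hq : q = i
    · subst hq
      rw [Function.update_self]
      omega
    · rwa [Function.update_of_ne hq]

/-- Downward induction from `β` along unit moves of single entries of increasing tuples. -/
theorem StrictMono.update_induction {k : ℕ} {β : Fin k → ℕ} (hβ : StrictMono β)
    {P : (Fin k → ℕ) → Prop} (base : P β)
    (step : ∀ γ i, StrictMono γ → StrictMono (Function.update γ i (γ i + 1)) →
      P (Function.update γ i (γ i + 1)) → P γ)
    {γ : Fin k → ℕ} (hγ : StrictMono γ) (hle : γ ≤ β) : P γ := by
  induction hd : ∑ i, (β i - γ i) using Nat.strong_induction_on generalizing γ with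
  | _ d ih =>
    by_cases hne : γ = β
    · exact hne ▸ base
    obtain ⟨i, hi, hmono⟩ := hγ.exists_update_succ hβ hle hne
    refine step γ i hγ hmono (ih _ ?_ hmono ?_ rfl)
    · rw [← hd]
      refine Finset.sum_lt_sum (fun l _ => ?_) ⟨i, Finset.mem_univ i, ?_⟩
      · by_cases hl : l = i
        · subst hl
          rw [Function.update_self]
          omega
        · rw [Function.update_of_ne hl]
      · rw [Function.update_self]
        omega
    · intro l
      by_cases hl : l = i
      · subst hl
        rw [Function.update_self]
        exact hi
      · rw [Function.update_of_ne hl]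
        exact hle l

theorem StrictMono.val_le {k : ℕ} {f : Fin k → ℕ} (hf : StrictMono f) (i : Fin k) :
    (i : ℕ) ≤ f i := by
  obtain ⟨i, hi⟩ := i
  induction i with
  | zero => exact Nat.zero_le _
  | succ i ih =>
    have h1 := ih (by omega)
    have h2 : f ⟨i, by omega⟩ < f ⟨i + 1, hi⟩ := hf (by simp)
    simp only at h1 ⊢
    omega

/-- Add `s` times the `j`-th vector to the `(j + 1)`-st vector. -/
def shear {E : Type*} [AddCommGroup E] [Module ℝ E] (v : ℕ → E) (j : ℕ) (s : ℝ) : ℕ → E :=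
  Function.update v (j + 1) (v (j + 1) + s • v j)

theorem det_shear_of_mem {k : ℕ} (v : ℕ → Fin k → ℝ) {f : Fin k → ℕ} (hf : f.Injective) {j : ℕ}
    {i : Fin k} (hi : f i = j + 1) (s : ℝ) :
    (Matrix.of fun l => shear v j s (f l)).det =
      (Matrix.of fun l => v (f l)).det +
        s * (Matrix.of fun l => v (Function.update f i j l)).det := by
  have h1 : (Matrix.of fun l => shear v j s (f l)) =
      (Matrix.of fun l => v (f l)).updateRow i (v (f i) + s • v j) := by
    ext l m
    by_cases hl : l = i
    · subst hl
      simp [shear, hi]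
    · have : f l ≠ j + 1 := fun h => hl (hf (h.trans hi.symm))
      simp [shear, hl, this]
  have h2 : (Matrix.of fun l => v (Function.update f i j l)) =
      (Matrix.of fun l => v (f l)).updateRow i (v j) := by
    ext l m
    by_cases hl : l = i
    · subst hl
      simp
    · simp [hl]
  have h3 : (Matrix.of fun l => v (f l)).updateRow i (v (f i)) = Matrix.of fun l => v (f l) :=
    Matrix.updateRow_eq_self _ i
  rw [h1, Matrix.det_updateRow_add, Matrix.det_updateRow_smul, h3, h2]

theorem det_shear_update_succ {k : ℕ} (v : ℕ → Fin k → ℝ) {γ : Fin k → ℕ} {i : Fin k}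
    (h : StrictMono (Function.update γ i (γ i + 1))) (s : ℝ) :
    (Matrix.of fun l => shear v (γ i) s (Function.update γ i (γ i + 1) l)).det =
      (Matrix.of fun l => v (Function.update γ i (γ i + 1) l)).det +
        s * (Matrix.of fun l => v (γ l)).det := by
  rw [det_shear_of_mem v h.injective (Function.update_self ..)]
  simp

theorem exists_det_shear {k : ℕ} (v : ℕ → Fin k → ℝ) {f : Fin k → ℕ} (hf : StrictMono f)
    (j : ℕ) :
    ∃ e : ℝ, (e = 0 ∨ ∃ g : Fin k → ℕ, StrictMono g ∧ e = (Matrix.of fun l => v (g l)).det) ∧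
      ∀ s, (Matrix.of fun l => shear v j s (f l)).det =
        (Matrix.of fun l => v (f l)).det + s * e := by
  by_cases hex : ∃ i, f i = j + 1
  · obtain ⟨i, hi⟩ := hex
    refine ⟨_, ?_, det_shear_of_mem v hf.injective hi⟩
    by_cases hj : ∃ l, f l = j
    · obtain ⟨l, hl⟩ := hj
      have hli : l ≠ i := fun h => by rw [h] at hl; omega
      refine Or.inl (Matrix.det_zero_of_row_eq hli ?_)
      funext m
      simp [hli, hl]
    · refine Or.inr ⟨_, fun p q hpq => ?_, rfl⟩
      have h0 := hf hpq
      by_cases hp : p = i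
      · subst hp
        rw [Function.update_self, Function.update_of_ne hpq.ne']
        omega
      · rw [Function.update_of_ne hp]
        by_cases hq : q = i
        · subst hq
          rw [Function.update_self]
          exact lt_of_le_of_ne (by omega) fun h => hj ⟨p, h⟩
        · rwa [Function.update_of_ne hq]
  · refine ⟨0, Or.inl rfl, fun s => ?_⟩
    push Not at hex
    simp [shear, hex]

theorem shear_det_nonneg {k : ℕ} {v : ℕ → Fin k → ℝ} {ε : ℝ}
    (h : ∀ f : Fin k → ℕ, StrictMono f → 0 ≤ ε * (Matrix.of fun l => v (f l)).det)
    (j : ℕ) {s : ℝ} (hs : 0 ≤ s) {f : Fin k → ℕ} (hf : StrictMono f) :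
    0 ≤ ε * (Matrix.of fun l => shear v j s (f l)).det := by
  obtain ⟨e, he, hdet⟩ := exists_det_shear v hf j
  have he' : 0 ≤ ε * e := by
    rcases he with rfl | ⟨g, hg, rfl⟩
    · simp
    · exact h g hg
  rw [hdet, mul_add, mul_left_comm]
  exact add_nonneg (h f hf) (mul_nonneg hs he')

/-- Positivity of all minors whose row tuple is a block tuple propagates to nonnegativity of all
minors of the same order. -/
theorem minor_nonneg_of_blockIndex {m : ℕ} {ε : ℝ} {β : Fin (m + 1) → ℕ} (hβ : StrictMono β)
    {X : ℕ → ℕ → ℝ}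
    (h : ∀ r s, 1 ≤ r → r ≤ m + 1 → ∀ g : Fin (m + 1) → ℕ, StrictMono g →
      0 ≤ ε * (Matrix.of fun l i => X (blockIndex (m + 1) r s i) (g l)).det)
    (hpos : ∀ r s, 1 ≤ r → r ≤ m + 1 →
      0 < ε * (Matrix.of fun (l i : Fin (m + 1)) => X (blockIndex (m + 1) r s i) (l : ℕ)).det)
    {f : Fin (m + 1) → ℕ} (hf : StrictMono f) :
    0 ≤ ε * (Matrix.of fun l i => X (f i) (β l)).det := by
  suffices H : ∀ Y : ℕ → ℕ → ℝ,
      (∀ r s, 1 ≤ r → r ≤ m + 1 → ∀ g : Fin (m + 1) → ℕ, StrictMono g →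
        0 ≤ ε * (Matrix.of fun l i => Y (blockIndex (m + 1) r s i) (g l)).det) →
      (∀ r s, 1 ≤ r → r ≤ m + 1 →
        0 < ε * (Matrix.of fun (l i : Fin (m + 1)) => Y (blockIndex (m + 1) r s i) (l : ℕ)).det) →
      0 ≤ ε * (Matrix.of fun l i => Y (f i) (β l)).det from H X h hpos
  refine StrictMono.update_induction hβ (γ := fun l => (l : ℕ)) (P := fun γ => ∀ Y : ℕ → ℕ → ℝ,
      (∀ r s, 1 ≤ r → r ≤ m + 1 → ∀ g : Fin (m + 1) → ℕ, StrictMono g →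
        0 ≤ ε * (Matrix.of fun l i => Y (blockIndex (m + 1) r s i) (g l)).det) →
      (∀ r s, 1 ≤ r → r ≤ m + 1 →
        0 < ε * (Matrix.of fun (l i : Fin (m + 1)) => Y (blockIndex (m + 1) r s i) (γ l)).det) →
      0 ≤ ε * (Matrix.of fun l i => Y (f i) (β l)).det) ?_ ?_ (fun _ _ h => h) hβ.val_le
  · intro Y _ hY
    have hF := isPlucker_det ε fun i l => Y i (β l)
    have key : ∀ g : Fin (m + 1) → ℕ, (Matrix.of fun l i => Y (g i) (β l)).det =
        (Matrix.of fun i l => Y (g i) (β l)).det := fun g => (Matrix.det_transpose _).symm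
    simp only [key] at hY ⊢
    exact (hF.pos_of_blockIndex (f (Fin.last m) + 1) (fun r s hr hrm _ => hY r s hr hrm) hf
      fun i => Nat.lt_succ_of_le (hf.monotone (Fin.le_last i))).le
  · intro γ i hγ hmono ih Y h1 h2
    set Z : ℝ → ℕ → ℕ → ℝ := fun s p => shear (Y p) (γ i) s with hZ
    have hZ' : ∀ (s : ℝ) (a g : Fin (m + 1) → ℕ), (Matrix.of fun l i => Z s (a i) (g l)) =
        Matrix.of fun l => shear (fun q i => Y (a i) q) (γ i) s (g l) := by
      intro s a g
      ext l p
      by_cases hl : g l = γ i + 1 <;> simp [hZ, shear, hl]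
    have hpos : ∀ s > 0, 0 ≤ ε * (Matrix.of fun l i => Z s (f i) (β l)).det := by
      intro s hs
      refine ih (Z s) (fun r t hr hrm g hg => ?_) fun r t hr hrm => ?_
      · rw [hZ']
        exact shear_det_nonneg (h1 r t hr hrm) _ hs.le hg
      · rw [hZ', det_shear_update_succ _ hmono, mul_add, mul_left_comm]
        exact add_pos_of_nonneg_of_pos (h1 r t hr hrm _ hmono) (mul_pos hs (h2 r t hr hrm))
    obtain ⟨e, -, he⟩ := exists_det_shear (fun q l => Y (f l) q) hβ (γ i)
    simp only [hZ', he] at hpos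
    have hlim : Tendsto (fun s : ℝ => ε * ((Matrix.of fun l i => Y (f i) (β l)).det + s * e))
        (nhdsWithin 0 (Set.Ioi 0)) (nhds (ε * (Matrix.of fun l i => Y (f i) (β l)).det)) := by
      have : Continuous fun s : ℝ => ε * ((Matrix.of fun l i => Y (f i) (β l)).det + s * e) := by
        fun_prop
      simpa using (this.tendsto 0).mono_left nhdsWithin_le_nhds
    exact ge_of_tendsto hlim (eventually_mem_nhdsWithin.mono hpos)

theorem sum_dotProduct_mul_det_succAbove {k : ℕ} (w : Fin (k + 1) → Fin k → ℝ) (φ : Fin k → ℝ) :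
    ∑ i : Fin (k + 1), (-1) ^ (i : ℕ) * (w i ⬝ᵥ φ) *
      (Matrix.of fun j => w (i.succAbove j)).det = 0 := by
  set M : Matrix (Fin (k + 1)) (Fin (k + 1)) ℝ :=
    Matrix.of fun i => Fin.cons (w i ⬝ᵥ φ) (w i) with hM
  have hdet : M.det = 0 := by
    refine Matrix.exists_mulVec_eq_zero_iff.1 ⟨Fin.cons 1 (-φ), fun h => ?_, ?_⟩
    · simpa using congrFun h 0
    · ext i
      simp [hM, Matrix.mulVec, dotProduct, Fin.sum_univ_succ]
  rw [← hdet, Matrix.det_succ_column_zero]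
  refine Finset.sum_congr rfl fun i _ => ?_
  rfl

theorem continuous_shear_dotProduct {k : ℕ} (v : ℕ → Fin k → ℝ) (w : Fin k → ℝ) (j l : ℕ) :
    Continuous fun s : ℝ => shear v j s l ⬝ᵥ w := by
  by_cases hl : l = j + 1
  · subst hl
    simp only [shear, Function.update_self, add_dotProduct, smul_dotProduct, smul_eq_mul]
    fun_prop
  · simp only [shear, Function.update_of_ne hl]
    fun_prop

theorem not_alternates_of_det_castSucc_pos {m : ℕ} {v : ℕ → Fin (m + 1) → ℝ} {ε : ℝ}
    (hv : ∀ f : Fin (m + 1) → ℕ, StrictMono f → 0 ≤ ε * (Matrix.of fun l => v (f l)).det)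
    (w : Fin (m + 1) → ℝ) {a : Fin (m + 2) → ℕ} (ha : StrictMono a)
    (hpos : 0 < ε * (Matrix.of fun l => v (a (Fin.castSucc l))).det) :
    ¬ ∀ i : Fin (m + 1), (v (a i.castSucc) ⬝ᵥ w) * (v (a i.succ) ⬝ᵥ w) < 0 := by
  intro halt
  set y : Fin (m + 2) → ℝ := fun i => v (a i) ⬝ᵥ w with hy
  have hsign : ∀ i : Fin (m + 2), 0 < (y 0 * (-1) ^ (i : ℕ)) * y i := by
    intro i
    induction i using Fin.induction with
    | zero =>
      have h0 : y 0 ≠ 0 := left_ne_zero_of_mul (halt 0).ne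
      simpa using mul_self_pos.2 h0
    | succ i ih =>
      have h1 := mul_neg_of_mul_pos (by rwa [mul_comm]) (halt i)
      simp only [Fin.val_castSucc] at h1
      simp only [Fin.val_succ, pow_succ]
      linarith
  have hsum := sum_dotProduct_mul_det_succAbove (fun i => v (a i)) w
  have hpos' : 0 < y 0 * ε * ∑ i : Fin (m + 2), (-1) ^ (i : ℕ) * y i *
      (Matrix.of fun j => v (a (i.succAbove j))).det := by
    rw [Finset.mul_sum]
    have key : ∀ i : Fin (m + 2), y 0 * ε * ((-1) ^ (i : ℕ) * y i *
        (Matrix.of fun j => v (a (i.succAbove j))).det) = (y 0 * (-1) ^ (i : ℕ) * y i) *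
          (ε * (Matrix.of fun j => v (a (i.succAbove j))).det) := fun i => by ring
    refine Finset.sum_pos' (fun i _ => ?_) ⟨Fin.last _, Finset.mem_univ _, ?_⟩
    · rw [key]
      exact mul_nonneg (hsign i).le (hv _ (ha.comp (Fin.strictMono_succAbove i)))
    · rw [key]
      refine mul_pos (hsign _) ?_
      simpa only [Fin.succAbove_last] using hpos
  rw [show (∑ i : Fin (m + 2), (-1) ^ (i : ℕ) * y i *
      (Matrix.of fun j => v (a (i.succAbove j))).det) = 0 from hsum, mul_zero] at hpos'
  exact hpos'.false

theorem not_alternates_dotProduct {m : ℕ} {v : ℕ → Fin (m + 1) → ℝ} {ε : ℝ}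
    (hv : ∀ f : Fin (m + 1) → ℕ, StrictMono f → 0 ≤ ε * (Matrix.of fun l => v (f l)).det)
    (hpos : 0 < ε * (Matrix.of fun l : Fin (m + 1) => v l).det) (w : Fin (m + 1) → ℝ) :
    ¬ Alternates (fun i => v i ⬝ᵥ w) (m + 1) := by
  rintro ⟨a, ha, halt⟩
  have hβ : StrictMono (a ∘ Fin.castSucc) := ha.comp Fin.strictMono_castSucc
  refine StrictMono.update_induction hβ (P := fun γ => ∀ v : ℕ → Fin (m + 1) → ℝ,
    (∀ f : Fin (m + 1) → ℕ, StrictMono f → 0 ≤ ε * (Matrix.of fun l => v (f l)).det) →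
    0 < ε * (Matrix.of fun l => v (γ l)).det →
    ¬ ∀ i : Fin (m + 1), (v (a i.castSucc) ⬝ᵥ w) * (v (a i.succ) ⬝ᵥ w) < 0)
    (fun v hv hpos => not_alternates_of_det_castSucc_pos hv w ha hpos)
    (fun γ i _ hmono ih v hv hpos halt => ?_) (Fin.val_strictMono) hβ.val_le v hv hpos halt
  have hev : ∀ᶠ s : ℝ in nhdsWithin 0 (Set.Ioi 0), ∀ l : Fin (m + 1),
      (shear v (γ i) s (a l.castSucc) ⬝ᵥ w) * (shear v (γ i) s (a l.succ) ⬝ᵥ w) < 0 := by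
    refine eventually_all.2 fun l => nhdsWithin_le_nhds ?_
    refine ((continuous_shear_dotProduct v w _ _).mul
      (continuous_shear_dotProduct v w _ _)).continuousAt.eventually_lt continuousAt_const ?_
    simpa [shear] using halt l
  obtain ⟨s, hs, hs0⟩ := (hev.and self_mem_nhdsWithin).exists
  have hs0 : 0 < s := hs0
  refine ih _ (fun f hf => shear_det_nonneg hv _ hs0.le hf) ?_ hs
  rw [det_shear_update_succ v hmono]
  have := hv _ hmono
  have := mul_pos hs0 hpos
  linarith

theorem exists_convex_split {x y : ℝ} (h : 0 ≤ x * y) :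
    ∃ a b v : ℝ, 0 ≤ a ∧ 0 ≤ b ∧ a + b = 1 ∧ x = a * v ∧ y = b * v := by
  by_cases hxy : x + y = 0
  · have hx : x = 0 := by nlinarith
    have hy : y = 0 := by linarith
    exact ⟨1, 0, 0, by simp [hx, hy]⟩
  · have hx : 0 ≤ x * (x + y) := by nlinarith [mul_self_nonneg x, mul_self_nonneg y]
    have hy : 0 ≤ y * (x + y) := by nlinarith [mul_self_nonneg x, mul_self_nonneg y]
    refine ⟨x / (x + y), y / (x + y), x + y, ?_, ?_, ?_, ?_, ?_⟩
    · rwa [← mul_div_mul_right _ _ hxy, le_div_iff₀ (mul_self_pos.2 hxy), zero_mul]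
    · rwa [← mul_div_mul_right _ _ hxy, le_div_iff₀ (mul_self_pos.2 hxy), zero_mul]
    all_goals field_simp

theorem Fin.succAbove_succ_eq_succAbove_castSucc {M : ℕ} {j l : Fin M} (h : l ≠ j) :
    j.succ.succAbove l = j.castSucc.succAbove l := by
  rcases lt_or_gt_of_ne h with h | h
  · rw [Fin.succAbove_succ_of_le _ _ h.le, Fin.succAbove_castSucc_of_lt _ _ h]
  · rw [Fin.succAbove_succ_of_lt _ _ h, Fin.succAbove_castSucc_of_le _ _ h.le]

/-- Replace the entries `x j` and `x (j + 1)` by the single entry `a * x j + b * x (j + 1)`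
(when `a + b = 1`). -/
def mergeAt {M : ℕ} (j : Fin M) (a b : ℝ) (x : Fin (M + 1) → ℝ) : Fin M → ℝ :=
  fun l => a * x (j.succ.succAbove l) + b * x (j.castSucc.succAbove l)

theorem mergeAt_of_ne {M : ℕ} {j : Fin M} {a b : ℝ} (hab : a + b = 1) (x : Fin (M + 1) → ℝ)
    {l : Fin M} (h : l ≠ j) : mergeAt j a b x l = x (j.succ.succAbove l) := by
  rw [mergeAt, ← Fin.succAbove_succ_eq_succAbove_castSucc h, ← add_mul, hab, one_mul]

theorem mergeAt_self {M : ℕ} (j : Fin M) (a b : ℝ) (x : Fin (M + 1) → ℝ) :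
    mergeAt j a b x j = a * x j.castSucc + b * x j.succ := by
  simp [mergeAt]

theorem det_mergeAt {k M : ℕ} {j : Fin M} {a b : ℝ} (hab : a + b = 1)
    (x : Fin k → Fin (M + 1) → ℝ) {g : Fin k → Fin M} (hg : g.Injective) :
    (Matrix.of fun p q => mergeAt j a b (x p) (g q)).det =
      a * (Matrix.of fun p q => x p (j.succ.succAbove (g q))).det +
        b * (Matrix.of fun p q => x p (j.castSucc.succAbove (g q))).det := by
  by_cases hj : ∃ q, g q = j
  · obtain ⟨q₀, rfl⟩ := hj
    set S := Matrix.of fun p q => x p ((g q₀).succ.succAbove (g q)) with hS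
    have h1 : (Matrix.of fun p q => mergeAt (g q₀) a b (x p) (g q)) =
        S.updateCol q₀ ((a • fun p => x p (g q₀).castSucc) + b • fun p => x p (g q₀).succ) := by
      ext p q
      by_cases hq : q = q₀
      · subst hq
        simp [mergeAt_self]
      · simp [Matrix.updateCol_ne hq, mergeAt_of_ne hab _ (hg.ne hq), hS]
    have h2 : (Matrix.of fun p q => x p ((g q₀).castSucc.succAbove (g q))) =
        S.updateCol q₀ fun p => x p (g q₀).succ := by
      ext p q
      by_cases hq : q = q₀
      · subst hq
        simp
      · simp [Matrix.updateCol_ne hq, Fin.succAbove_succ_eq_succAbove_castSucc (hg.ne hq), hS]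
    have h3 : S = S.updateCol q₀ fun p => x p (g q₀).castSucc := by
      ext p q
      by_cases hq : q = q₀
      · subst hq
        simp [hS]
      · simp [Matrix.updateCol_ne hq]
    rw [h1, h2, Matrix.det_updateCol_add, Matrix.det_updateCol_smul, Matrix.det_updateCol_smul,
      ← h3]
  · push Not at hj
    simp only [mergeAt_of_ne hab _ (hj _), ← Fin.succAbove_succ_eq_succAbove_castSucc (hj _),
      ← add_mul, hab, one_mul]

theorem mergeAt_dotProduct {M : ℕ} {j : Fin M} {a b v : ℝ} (hab : a + b = 1)
    (x : Fin (M + 1) → ℝ) {u : Fin (M + 1) → ℝ} (ha : u j.castSucc = a * v)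
    (hb : u j.succ = b * v) :
    mergeAt j a b x ⬝ᵥ Function.update (fun l => u (j.succ.succAbove l)) j v = x ⬝ᵥ u := by
  have hterm : ∀ l, mergeAt j a b x l * Function.update (fun l => u (j.succ.succAbove l)) j v l =
      x (j.succ.succAbove l) * u (j.succ.succAbove l) +
        if l = j then x j.succ * u j.succ else 0 := by
    intro l
    by_cases hl : l = j
    · subst hl
      rw [mergeAt_self]
      simp [ha, hb]
      ring
    · simp [mergeAt_of_ne hab _ hl, hl]
  simp only [dotProduct]
  rw [Finset.sum_congr rfl fun l _ => hterm l, Finset.sum_add_distrib,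
    Fin.sum_univ_succAbove (fun i => x i * u i) j.succ, add_comm]
  simp

theorem Alternates.comp_of_pos {ι κ : Type*} [Preorder ι] [Preorder κ] {u : ι → ℝ} {w : κ → ℝ}
    {k : ℕ} (h : Alternates u k) {e : ι → κ} (he : StrictMono e)
    (hp : ∀ i, ∃ p, 0 < p ∧ u i = p⁻¹ * w (e i)) : Alternates w k := by
  obtain ⟨a, ha, halt⟩ := h
  refine ⟨e ∘ a, he.comp ha, fun i => ?_⟩
  obtain ⟨p, hp0, hp1⟩ := hp (a i.castSucc)
  obtain ⟨q, hq0, hq1⟩ := hp (a i.succ)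
  have := halt i
  rw [hp1, hq1, mul_mul_mul_comm] at this
  exact (pos_iff_neg_of_mul_neg this).1 (by positivity)

theorem Alternates.of_merge {M k : ℕ} {j : Fin M} {a b v : ℝ} (ha0 : 0 ≤ a) (hab : a + b = 1)
    {u : Fin (M + 1) → ℝ} (ha : u j.castSucc = a * v) (hb : u j.succ = b * v)
    (h : Alternates (Function.update (fun l => u (j.succ.succAbove l)) j v) k) :
    Alternates u k := by
  rcases ha0.eq_or_lt with rfl | ha0
  · refine h.comp_of_pos (Fin.strictMono_succAbove j.castSucc) fun i => ⟨1, one_pos, ?_⟩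
    by_cases hi : i = j
    · subst hi
      simp_all
    · simp [hi, Fin.succAbove_succ_eq_succAbove_castSucc hi]
  · refine h.comp_of_pos (Fin.strictMono_succAbove j.succ) fun i => ?_
    by_cases hi : i = j
    · subst hi
      exact ⟨a, ha0, by simp [ha, ha0.ne']⟩
    · exact ⟨1, one_pos, by simp [hi]⟩

theorem exists_mul_succ_nonneg {M k : ℕ} (hk : k ≤ M) {u : Fin (M + 1) → ℝ}
    (h : ¬ Alternates u k) : ∃ j : Fin M, 0 ≤ u j.castSucc * u j.succ := by
  by_contra! hneg
  exact h ⟨Fin.castLE (by omega), Fin.strictMono_castLE _, fun i => hneg (Fin.castLE hk i)⟩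

theorem not_alternates_of_minors {m M : ℕ} (hM : m + 1 ≤ M) {ε : ℝ} {X : ℕ → Fin M → ℝ}
    (hX : ∀ (f : Fin (m + 1) → ℕ) (g : Fin (m + 1) → Fin M), StrictMono f → StrictMono g →
      0 ≤ ε * (Matrix.of fun p q => X (f p) (g q)).det)
    (hpos : ∀ g : Fin (m + 1) → Fin M, StrictMono g →
      0 < ε * (Matrix.of fun (p q : Fin (m + 1)) => X p (g q)).det)
    {u : Fin M → ℝ} (hu : ¬ Alternates u (m + 1)) :
    ¬ Alternates (fun i => X i ⬝ᵥ u) (m + 1) := by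
  induction M, hM using Nat.le_induction with
  | base =>
    exact not_alternates_dotProduct (fun f hf => hX f id hf strictMono_id)
      (hpos id strictMono_id) u
  | succ M hM ih =>
    obtain ⟨j, hj⟩ := exists_mul_succ_nonneg hM hu
    obtain ⟨a, b, v, ha, hb, hab, hua, hub⟩ := exists_convex_split hj
    have := ih (X := fun i => mergeAt j a b (X i)) (fun f g hf hg => ?_) (fun g hg => ?_)
      (u := Function.update (fun l => u (j.succ.succAbove l)) j v)
      fun h => hu (h.of_merge ha hab hua hub)
    · simpa only [mergeAt_dotProduct hab _ hua hub] using this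
    · rw [det_mergeAt hab _ hg.injective, mul_add, mul_left_comm, mul_left_comm ε b]
      have h1 := hX f _ hf ((Fin.strictMono_succAbove j.succ).comp hg)
      have h2 := hX f _ hf ((Fin.strictMono_succAbove j.castSucc).comp hg)
      exact add_nonneg (mul_nonneg ha h1) (mul_nonneg hb h2)
    · rw [det_mergeAt hab (fun p : Fin (m + 1) => X p) hg.injective, mul_add, mul_left_comm,
        mul_left_comm ε b]
      have h1 := hpos _ ((Fin.strictMono_succAbove j.succ).comp hg)
      have h2 := hpos _ ((Fin.strictMono_succAbove j.castSucc).comp hg)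
      rcases ha.eq_or_lt with rfl | ha
      · obtain rfl : b = 1 := by linarith
        simpa using h2
      · exact add_pos_of_pos_of_nonneg (mul_pos ha h1) (mul_nonneg hb h2.le)

theorem obsMat_submatrix_eq {n k N : ℕ} (A : Matrix (Fin n) (Fin n) ℝ) (c : Fin n → ℝ)
    (f : Fin k → Fin N) (g : Fin k → Fin n) :
    (obsMat A c N).submatrix f g =
      Matrix.of fun p q => Matrix.vecMul c (A ^ (f p : ℕ)) (g q) := rfl

/-- Extend `x : Fin n → ℝ` by zero to all of `ℕ`. -/
noncomputable def zeroExtend {n : ℕ} (x : Fin n → ℝ) (j : ℕ) : ℝ :=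
  if h : j < n then x ⟨j, h⟩ else 0

theorem zeroExtend_val {n : ℕ} (x : Fin n → ℝ) (j : Fin n) : zeroExtend x j = x j := by
  simp [zeroExtend]

theorem zeroExtend_of_le {n : ℕ} (x : Fin n → ℝ) {j : ℕ} (h : n ≤ j) : zeroExtend x j = 0 := by
  simp [zeroExtend, h.not_gt]

theorem blockIndex_le (m r s : ℕ) (i : Fin (m + 1)) : blockIndex (m + 1) r s i ≤ m + s := by
  simp only [blockIndex]
  split_ifs <;> omega

/-- Nonnegativity of block minors in `X` with the columns extended by zero. -/
theorem minor_nonneg_of_block_minors {n m : ℕ} {ε : ℝ} {X : ℕ → Fin n → ℝ}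
    (hlt : ∀ r s, 1 ≤ r → r ≤ m + 1 → ∀ q b, 1 ≤ q → q ≤ m → m + b < n →
      0 < ε * (Matrix.of fun l i => zeroExtend (X (blockIndex (m + 1) r s i))
        (blockIndex (m + 1) q b l)).det)
    (hle : ∀ r s, 1 ≤ r → r ≤ m + 1 → ∀ b, m + b < n →
      0 ≤ ε * (Matrix.of fun l i => zeroExtend (X (blockIndex (m + 1) r s i))
        (blockIndex (m + 1) (m + 1) b l)).det)
    (hval : ∀ r s, 1 ≤ r → r ≤ m + 1 →
      0 < ε * (Matrix.of fun (l i : Fin (m + 1)) => zeroExtend (X (blockIndex (m + 1) r s i))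
        (l : ℕ)).det)
    {f : Fin (m + 1) → ℕ} (hf : StrictMono f) {g : Fin (m + 1) → Fin n} (hg : StrictMono g) :
    0 ≤ ε * (Matrix.of fun p q => X (f p) (g q)).det := by
  have h := minor_nonneg_of_blockIndex (ε := ε) (β := fun q => (g q : ℕ))
    (fun i j hij => hg hij) (X := fun i => zeroExtend (X i)) (fun r s hr hr' γ hγ => ?_) hval hf
  · rw [← Matrix.det_transpose]
    simp only [zeroExtend_val] at h
    exact h
  · by_cases hlast : γ (Fin.last m) < n
    · have hF := isPlucker_det ε fun j i => zeroExtend (X (blockIndex (m + 1) r s i)) j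
      refine hF.nonneg_of_blockIndex n
        (fun q b hq hq' hb => hlt r s hr hr' q b hq hq' hb) (fun b hb => hle r s hr hr' b hb) hγ
        fun i => (hγ.monotone (Fin.le_last i)).trans_lt hlast
    · rw [Matrix.det_eq_zero_of_row_eq_zero (Fin.last m), mul_zero]
      exact fun i => zeroExtend_of_le _ (not_lt.1 hlast)

/-- Block minors using the first rows determine positivity of all minors using the first rows. -/
theorem minor_pos_of_block_minors {n m : ℕ} {ε : ℝ} {X : ℕ → Fin n → ℝ}
    (hlt : ∀ q b, 1 ≤ q → q ≤ m + 1 → m + b < n →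
      0 < ε * (Matrix.of fun (l i : Fin (m + 1)) => zeroExtend (X i)
        (blockIndex (m + 1) q b l)).det)
    {g : Fin (m + 1) → Fin n} (hg : StrictMono g) :
    0 < ε * (Matrix.of fun (p q : Fin (m + 1)) => X p (g q)).det := by
  have h := (isPlucker_det ε fun j (i : Fin (m + 1)) => zeroExtend (X i) j).pos_of_blockIndex n
    hlt (f := fun q => (g q : ℕ)) (fun i j hij => hg hij) fun i => (g i).2
  rw [← Matrix.det_transpose]
  simp only [zeroExtend_val] at h
  exact h

theorem Alternates.of_val {t k : ℕ} {w : Fin t → ℝ} {y : ℕ → ℝ} (h : Alternates w k)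
    (hw : ∀ i : Fin t, w i = y i) : Alternates y k :=
  h.comp_of_pos (e := Fin.val) Fin.val_strictMono fun i => ⟨1, one_pos, by simp [hw]⟩

theorem obsVB_of_minors {n m : ℕ} {A : Matrix (Fin n) (Fin n) ℝ} {c : Fin n → ℝ} (hm : m + 1 ≤ n)
    {ε : ℝ}
    (hX : ∀ (f : Fin (m + 1) → ℕ) (g : Fin (m + 1) → Fin n), StrictMono f → StrictMono g →
      0 ≤ ε * (Matrix.of fun p q => Matrix.vecMul c (A ^ f p) (g q)).det)
    (hpos : ∀ g : Fin (m + 1) → Fin n, StrictMono g →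
      0 < ε * (Matrix.of fun (p q : Fin (m + 1)) => Matrix.vecMul c (A ^ (p : ℕ)) (g q)).det) :
    ObsVB A c m := by
  intro t _ u _ hu
  by_contra! hlt
  have hu' : ¬ Alternates u (m + 1) := fun h => by
    have := le_variation_of_alternates (Nat.le_add_left 1 m) h
    push_cast at this
    omega
  have hlt' : ((m + 1 : ℕ) : ℤ) ≤ variation ((obsMat A c t).mulVec u) := by
    push_cast
    omega
  exact not_alternates_of_minors hm hX hpos hu'
    ((alternates_of_le_variation hlt').of_val (y := fun i => Matrix.vecMul c (A ^ i) ⬝ᵥ u)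
      fun i => rfl)

/-- a sufficient condition for the observability operator of an observable
`(A,c)` to be `(k-1)`-variation bounding, in terms of staircase minors of `O_N`, where for
fully consecutive column sets nonnegativity suffices provided the minors with `t ∈ {1,…,k}`
are strictly signed. -/
theorem stmt11 {n : ℕ} (A : Matrix (Fin n) (Fin n) ℝ) (c : Fin n → ℝ) (k : ℕ)
    (hobs : Observable A c) (hk : 1 ≤ k) (hkn : k ≤ n)
    (hcond : ∃ ε : ℝ, (ε = 1 ∨ ε = -1) ∧
      ∀ N : ℕ, k ≤ N → ∀ r ∈ Finset.Icc 1 k, ∀ t ∈ Finset.Icc 1 (N - k + 1),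
        ∀ rb ∈ Finset.Icc 1 k, ∀ tb ∈ Finset.Icc (k - rb + 1) (n - rb + 1),
          ∀ (f : Fin k → Fin N) (g : Fin k → Fin n),
            (∀ i : Fin k, (f i : ℕ) =
              if (i : ℕ) < k - r then (i : ℕ) else (i : ℕ) + t - 1) →
            (∀ i : Fin k, (g i : ℕ) =
              if (i : ℕ) < k - rb then (i : ℕ) else (i : ℕ) + tb - 1 - (k - rb)) →
            (if rb = k ∧ k + 1 ≤ tb
              then 0 ≤ ε * ((obsMat A c N).submatrix f g).det ∧
                (t ≤ k → 0 < ε * ((obsMat A c N).submatrix f g).det)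
              else 0 < ε * ((obsMat A c N).submatrix f g).det)) :
    ObsVB A c (k - 1) := by
  obtain ⟨m, rfl⟩ : ∃ m, k = m + 1 := ⟨k - 1, by omega⟩
  obtain ⟨ε, -, hε⟩ := hcond
  have hblock : ∀ r s, 1 ≤ r → r ≤ m + 1 → ∀ q b, 1 ≤ q → q ≤ m + 1 → m + b < n →
      0 ≤ ε * (Matrix.of fun l i => zeroExtend (Matrix.vecMul c (A ^ blockIndex (m + 1) r s i))
        (blockIndex (m + 1) q b l)).det ∧
      (q ≤ m ∨ b = 0 ∨ s = 0 → 0 < ε * (Matrix.of fun l i =>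
        zeroExtend (Matrix.vecMul c (A ^ blockIndex (m + 1) r s i))
          (blockIndex (m + 1) q b l)).det) := by
    intro r s hr hr' q b hq hq' hb
    have h := hε (m + 1 + s) (by omega) r (Finset.mem_Icc.2 ⟨hr, hr'⟩) (s + 1)
      (Finset.mem_Icc.2 ⟨by omega, by omega⟩) q (Finset.mem_Icc.2 ⟨hq, hq'⟩) (b + 1 + (m + 1 - q))
      (Finset.mem_Icc.2 ⟨by omega, by omega⟩)
      (fun i => ⟨blockIndex (m + 1) r s i, (blockIndex_le m r s i).trans_lt (by omega)⟩)
      (fun l => ⟨blockIndex (m + 1) q b l, (blockIndex_le m q b l).trans_lt hb⟩)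
      (fun i => by simp only [blockIndex]; split_ifs <;> omega)
      (fun l => by simp only [blockIndex]; split_ifs <;> omega)
    rw [obsMat_submatrix_eq, ← Matrix.det_transpose] at h
    simp only [← zeroExtend_val] at h
    split_ifs at h with hcase
    · refine ⟨h.1, fun hs => h.2 ?_⟩
      omega
    · exact ⟨h.le, fun _ => h⟩
  refine obsVB_of_minors (m := m) hkn (ε := ε) (fun f g hf hg => ?_) fun g hg => ?_
  · refine minor_nonneg_of_block_minors (X := fun i => Matrix.vecMul c (A ^ i))
      (fun r s hr hr' q b hq hq' hb => (hblock r s hr hr' q b hq (by omega) hb).2 (Or.inl hq'))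
      (fun r s hr hr' b hb => (hblock r s hr hr' (m + 1) b (by omega) le_rfl hb).1)
      (fun r s hr hr' => ?_) hf hg
    have hpos := (hblock r s hr hr' 1 0 le_rfl (by omega) (by omega)).2 (Or.inr (Or.inl rfl))
    simpa only [blockIndex_zero] using hpos
  · refine minor_pos_of_block_minors (X := fun i => Matrix.vecMul c (A ^ i))
      (fun q b hq hq' hb => ?_) hg
    have hpos := (hblock 1 0 le_rfl (by omega) q b hq hq' hb).2 (Or.inr (Or.inr rfl))
    simpa only [blockIndex_zero] using hpos
end

section
/- Let X be a real n×m matrix with rank(X) > k such that every k columns of X are linearly independent. Then X is (k−1)-variation diminishing if and only if X is k-sign regular. -/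
open Matrix Polynomial Filter

/-- `y` has at least `d` sign alternations: some `d + 1` of its entries, in order, are nonzero
with alternating signs. -/
def HasAlternations {n : ℕ} (y : Fin n → ℝ) (d : ℕ) : Prop :=
  ∃ f : Fin (d + 1) → Fin n, StrictMono f ∧ ∃ ε : ℝ,
    ∀ s : Fin (d + 1), 0 < ε * (-1) ^ (s : ℕ) * y (f s)

/-- A nonzero vector splits into `r + 1` consecutive nonzero blocks of constant alternating
signs, where `r` is its variation. -/
theorem exists_sign_blocks : ∀ {m : ℕ} (u : Fin m → ℝ), u ≠ 0 →
    ∃ (r : ℕ) (ε : ℝ) (b : Fin m → ℕ), (ε = 1 ∨ ε = -1) ∧ Monotone b ∧ (∀ l, b l ≤ r) ∧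
      (∀ l, 0 ≤ ε * (-1) ^ b l * u l) ∧ (∀ c ≤ r, ∃ l, b l = c ∧ u l ≠ 0) ∧
      ∃ x t, (List.ofFn u).filter (fun x => decide (x ≠ 0)) = x :: t ∧ 0 < ε * x ∧
        signChanges (x :: t) = r := by
  intro m
  induction m with
  | zero => intro u hu; exact absurd (Subsingleton.elim _ _) hu
  | succ m ih =>
    intro u hu
    set v : Fin m → ℝ := fun i => u i.succ with hv
    have hof : List.ofFn u = u 0 :: List.ofFn v := by simp [hv, List.ofFn_succ]
    have mono_cons : ∀ b : Fin m → ℕ, Monotone b → Monotone (Fin.cons 0 b : Fin (m + 1) → ℕ) := by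
      intro b hb i j hij
      induction i using Fin.cases with
      | zero => simp
      | succ i =>
        induction j using Fin.cases with
        | zero => simp at hij
        | succ j => simpa using hb (by simpa using hij)
    by_cases hv0 : v = 0
    · have hu0 : u 0 ≠ 0 := by
        intro h
        apply hu
        ext i
        induction i using Fin.cases with
        | zero => simpa using h
        | succ i => simpa [hv] using congrFun hv0 i
      have hvi : ∀ i : Fin m, u i.succ = 0 := fun i => congrFun hv0 i
      obtain ⟨ε, hε, hε0⟩ : ∃ ε : ℝ, (ε = 1 ∨ ε = -1) ∧ 0 < ε * u 0 := by
        rcases lt_or_gt_of_ne hu0 with h | h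
        · exact ⟨-1, Or.inr rfl, by linarith⟩
        · exact ⟨1, Or.inl rfl, by linarith⟩
      refine ⟨0, ε, fun _ => 0, hε, fun _ _ _ => le_rfl, fun _ => le_rfl, ?_, ?_, u 0, [], ?_, hε0,
        ?_⟩
      · intro l
        induction l using Fin.cases with
        | zero => simpa using hε0.le
        | succ i => simp [hvi]
      · intro c hc
        exact ⟨0, (Nat.le_zero.mp hc).symm, hu0⟩
      · rw [hof, hv0]
        simp [hu0]
      · simp [signChanges]
    · obtain ⟨r, ε, b, hε, hb, hbr, hs, hc, x, t, hxt, hx, hsc⟩ := ih v hv0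
      by_cases hag : 0 ≤ ε * u 0
      · have key : ∃ x' t', (List.ofFn u).filter (fun x => decide (x ≠ 0)) = x' :: t' ∧
            0 < ε * x' ∧ signChanges (x' :: t') = r := by
          by_cases h0 : u 0 = 0
          · exact ⟨x, t, by rw [hof, ← hxt]; simp [h0], hx, hsc⟩
          · refine ⟨u 0, x :: t, by rw [hof, ← hxt]; simp [h0], ?_, ?_⟩
            · exact lt_of_le_of_ne hag (by rcases hε with rfl | rfl <;> simpa [eq_comm] using h0)
            · rw [signChanges_cons_cons, hsc, if_neg, add_zero]
              rcases hε with rfl | rfl <;> nlinarith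
        refine ⟨r, ε, Fin.cons 0 b, hε, mono_cons b hb, ?_, ?_, ?_, key⟩
        · intro l
          induction l using Fin.cases with
          | zero => simp
          | succ i => simpa using hbr i
        · intro l
          induction l using Fin.cases with
          | zero => simpa using hag
          | succ i => simpa using hs i
        · intro c hcr
          obtain ⟨l, hl, hl0⟩ := hc c hcr
          exact ⟨l.succ, by simpa using hl, hl0⟩
      · push Not at hag
        have h0 : u 0 ≠ 0 := by rintro h; simp [h] at hag
        refine ⟨r + 1, -ε, Fin.cons 0 (fun i => b i + 1), ?_,
          mono_cons _ (fun i j h => Nat.add_le_add_right (hb h) 1), ?_, ?_, ?_, u 0, x :: t, ?_, ?_,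
          ?_⟩
        · rcases hε with rfl | rfl <;> simp
        · intro l
          induction l using Fin.cases with
          | zero => simp
          | succ i => simpa using hbr i
        · intro l
          induction l using Fin.cases with
          | zero => simpa using hag.le
          | succ i => simpa [pow_succ] using hs i
        · intro c hcr
          rcases c with _ | c
          · exact ⟨0, by simp, h0⟩
          · obtain ⟨l, hl, hl0⟩ := hc c (by omega)
            exact ⟨l.succ, by simpa using hl, hl0⟩
        · rw [hof, ← hxt]; simp [h0]
        · linarith
        · rw [signChanges_cons_cons, hsc, if_pos]
          rcases hε with rfl | rfl <;> nlinarith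

theorem variation_zero {m : ℕ} : variation (0 : Fin m → ℝ) = -1 := by
  have : (List.ofFn (0 : Fin m → ℝ)).filter (fun x => decide (x ≠ 0)) = [] := by
    rw [List.filter_eq_nil_iff]
    intro a ha
    obtain ⟨i, rfl⟩ := List.mem_ofFn.mp ha
    simp
  simp only [variation, this, if_true]

theorem not_hasAlternations_zero {m d : ℕ} : ¬ HasAlternations (0 : Fin m → ℝ) d := by
  rintro ⟨f, -, ε, h⟩
  simpa using h 0

/-- The number of blocks bounds the number of alternations. -/
theorem HasAlternations.le_of_blocks {m d r : ℕ} {u : Fin m → ℝ} (h : HasAlternations u d)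
    {ε : ℝ} {b : Fin m → ℕ} (hb : Monotone b) (hbr : ∀ l, b l ≤ r)
    (hs : ∀ l, 0 ≤ ε * (-1) ^ b l * u l) (hε : ε = 1 ∨ ε = -1) : d ≤ r := by
  obtain ⟨f, hf, η, hη⟩ := h
  have hmono : StrictMono (fun s => b (f s)) := by
    rw [Fin.strictMono_iff_lt_succ]
    intro s
    refine lt_of_le_of_ne (hb (hf.monotone (Fin.castSucc_lt_succ).le)) ?_
    intro heq
    have h1 := hη s.castSucc
    have h2 := hη s.succ
    have h3 := hs (f s.castSucc)
    have h4 := hs (f s.succ)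
    rw [← heq] at h4
    simp only [Fin.val_castSucc, Fin.val_succ, pow_succ] at h1 h2
    have h5 := mul_pos h1 h2
    have h6 := mul_nonneg h3 h4
    have e1 : ((-1 : ℝ) ^ (s : ℕ)) * (-1) ^ (s : ℕ) = 1 := by rw [← mul_pow]; simp
    have e2 : ((-1 : ℝ) ^ b (f s.castSucc)) * (-1) ^ b (f s.castSucc) = 1 := by
      rw [← mul_pow]; simp
    have e3 : ε * ε = 1 := by rcases hε with rfl | rfl <;> simp
    have h5' : 0 < -(η * η) * (u (f s.castSucc) * u (f s.succ)) := by
      calc 0 < _ := h5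
        _ = -(η * η) * (u (f s.castSucc) * u (f s.succ)) *
            (((-1 : ℝ) ^ (s : ℕ)) * (-1) ^ (s : ℕ)) := by ring
        _ = _ := by rw [e1, mul_one]
    have h6' : 0 ≤ u (f s.castSucc) * u (f s.succ) := by
      calc 0 ≤ _ := h6
        _ = (ε * ε) * (u (f s.castSucc) * u (f s.succ)) *
            (((-1 : ℝ) ^ b (f s.castSucc)) * (-1) ^ b (f s.castSucc)) := by ring
        _ = _ := by rw [e2, e3, mul_one, one_mul]
    nlinarith [mul_self_nonneg η, mul_nonneg (mul_self_nonneg η) h6']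
  have hle : ∀ s : Fin (d + 1), (s : ℕ) ≤ b (f s) := by
    intro s
    induction s using Fin.induction with
    | zero => simp
    | succ i ih =>
      have : b (f i.castSucc) < b (f i.succ) := hmono (Fin.castSucc_lt_succ (i := i))
      simp only [Fin.val_castSucc, Fin.val_succ] at ih ⊢
      omega
  exact (hle (Fin.last d)).trans (hbr _)

theorem le_variation_iff {m : ℕ} (u : Fin m → ℝ) (d : ℕ) :
    (d : ℤ) ≤ variation u ↔ HasAlternations u d := by
  by_cases hu : u = 0
  · subst hu
    rw [variation_zero]
    exact iff_of_false (by omega) not_hasAlternations_zero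
  obtain ⟨r, ε, b, hε, hb, hbr, hs, hc, x, t, hxt, -, hsc⟩ := exists_sign_blocks u hu
  have hvar : variation u = r := by
    simp only [variation, hxt, hsc]
    simp
  rw [hvar]
  constructor
  · intro hd
    have hd : d ≤ r := by exact_mod_cast hd
    choose g hg using fun c : Fin (d + 1) => hc c (by omega)
    refine ⟨g, ?_, ε, ?_⟩
    · intro i j hij
      by_contra hcon
      have := hb (not_lt.mp hcon)
      rw [(hg i).1, (hg j).1] at this
      exact absurd hij (not_lt.mpr this)
    · intro s
      have h1 := hs (g s)
      rw [(hg s).1] at h1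
      refine lt_of_le_of_ne h1 (Ne.symm (mul_ne_zero (mul_ne_zero ?_ ?_) (hg s).2))
      · rcases hε with rfl | rfl <;> simp
      · exact pow_ne_zero _ (by norm_num)
  · intro h
    exact_mod_cast h.le_of_blocks hb hbr hs hε

theorem linearIndepOn_iff_orderEmbOfFin {N d : ℕ} {E : Type*} [AddCommGroup E] [Module ℝ E]
    (v : Fin N → E) (S : Finset (Fin N)) (h : S.card = d) :
    LinearIndepOn ℝ v ↑S ↔ LinearIndependent ℝ (fun c => v (S.orderEmbOfFin h c)) :=
  (linearIndependent_equiv' (S.orderIsoOfFin h).toEquiv rfl).symm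

theorem linearIndepOn_row_iff_det_ne_zero {n d : ℕ} (A : Matrix (Fin n) (Fin d) ℝ)
    (S : Finset (Fin n)) (h : S.card = d) :
    LinearIndepOn ℝ A.row ↑S ↔ (A.submatrix (S.orderEmbOfFin h) id).det ≠ 0 := by
  rw [linearIndepOn_iff_orderEmbOfFin A.row S h, ← isUnit_iff_ne_zero,
    ← Matrix.isUnit_iff_isUnit_det, ← Matrix.linearIndependent_rows_iff_isUnit]
  rfl

theorem eq_orderEmbOfFin_of_strictMono {n d : ℕ} {f : Fin d → Fin n} (hf : StrictMono f) :
    ∃ (S : Finset (Fin n)) (h : S.card = d), ⇑(S.orderEmbOfFin h) = f := by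
  have h : (Finset.univ.image f).card = d := by
    rw [Finset.card_image_of_injective _ hf.injective]; simp
  exact ⟨_, h, (Finset.orderEmbOfFin_unique h (fun x => by simp) hf).symm⟩

theorem orderEmbOfFin_erase {n d : ℕ} {S : Finset (Fin n)} (hS : S.card = d + 1) {e : Fin n}
    (he : e ∈ S) (h : (S.erase e).card = d) :
    ∃ s : Fin (d + 1), ∀ c, (S.erase e).orderEmbOfFin h c = S.orderEmbOfFin hS (s.succAbove c) := by
  obtain ⟨s, hs⟩ : e ∈ Set.range (S.orderEmbOfFin hS) := by
    rw [Finset.range_orderEmbOfFin]; exact he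
  refine ⟨s, fun c => ?_⟩
  have := Finset.orderEmbOfFin_unique h (f := fun c => S.orderEmbOfFin hS (s.succAbove c))
    (fun x => ?_) ((S.orderEmbOfFin hS).strictMono.comp (Fin.strictMono_succAbove s))
  · exact (congrFun this c).symm
  · rw [Finset.mem_erase]
    refine ⟨?_, Finset.orderEmbOfFin_mem _ _ _⟩
    rw [← hs]
    exact fun hcon => Fin.succAbove_ne s x ((S.orderEmbOfFin hS).injective hcon)

/-- A matrix with independent columns has a nonzero maximal minor. -/
theorem exists_det_ne_zero_of_injective {n d : ℕ} (A : Matrix (Fin n) (Fin d) ℝ)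
    (hA : Function.Injective A.mulVec) :
    ∃ f : Fin d → Fin n, StrictMono f ∧ (A.submatrix f id).det ≠ 0 := by
  classical
  obtain ⟨b, -, -, hspan, hli⟩ := exists_linearIndepOn_extension (K := ℝ) (v := A.row)
    (linearIndepOn_empty ℝ A.row) (Set.empty_subset Set.univ)
  have hrank : A.rank = d := by
    rw [← Matrix.rank_transpose, LinearIndependent.rank_matrix]
    · simp
    · exact Matrix.mulVec_injective_iff.mp hA
  have hbc : b.toFinset.card = d := by
    rw [← hrank, Matrix.rank_eq_finrank_span_row]
    have h1 : Submodule.span ℝ (Set.range A.row) = Submodule.span ℝ (Set.range (fun x : b => A.row x)) := by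
      apply le_antisymm
      · rw [Submodule.span_le, ← Set.image_univ]
        refine hspan.trans ?_
        rw [Set.image_eq_range]
      · apply Submodule.span_mono
        rintro _ ⟨x, rfl⟩
        exact ⟨x, rfl⟩
    rw [h1, finrank_span_eq_card hli, Set.toFinset_card]
  refine ⟨_, (b.toFinset.orderEmbOfFin hbc).strictMono, ?_⟩
  rw [← linearIndepOn_row_iff_det_ne_zero]
  simpa using hli

theorem exists_notMem_span_of_card_lt {ι E : Type*} [AddCommGroup E] [Module ℝ E] (v : ι → E)
    {T S : Finset ι} (hS : LinearIndepOn ℝ v ↑S) (hTS : T.card < S.card) :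
    ∃ e ∈ S, v e ∉ Submodule.span ℝ (v '' ↑T) := by
  classical
  by_contra! hcon
  have h1 : Module.finrank ℝ (Submodule.span ℝ (v '' (S : Set ι))) = S.card := by
    rw [Set.image_eq_range, finrank_span_eq_card hS]; simp
  have h2 : Submodule.span ℝ (v '' (S : Set ι)) ≤ Submodule.span ℝ (v '' (T : Set ι)) := by
    rw [Submodule.span_le]
    rintro _ ⟨e, he, rfl⟩
    exact hcon e he
  have h3 : Module.finrank ℝ (Submodule.span ℝ (v '' (T : Set ι))) ≤ T.card := by
    rw [← Finset.coe_image]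
    exact (finrank_span_finset_le_card _).trans Finset.card_image_le
  have : FiniteDimensional ℝ (Submodule.span ℝ (v '' (T : Set ι))) :=
    FiniteDimensional.span_of_finite ℝ (T.finite_toSet.image v)
  have := Submodule.finrank_mono h2
  omega

/-- Independent sets of a fixed size are connected by single exchanges. -/
theorem of_exchange_of_linearIndepOn {ι E : Type*} [DecidableEq ι] [AddCommGroup E] [Module ℝ E]
    (v : ι → E) (d : ℕ) (P : Finset ι → Prop)
    (hadj : ∀ S S' : Finset ι, S.card = d → S'.card = d → LinearIndepOn ℝ v ↑S →
      LinearIndepOn ℝ v ↑S' → (S \ S').card = 1 → P S → P S') :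
    ∀ S S' : Finset ι, S.card = d → S'.card = d → LinearIndepOn ℝ v ↑S →
      LinearIndepOn ℝ v ↑S' → P S → P S' := by
  intro S S' hS hS' hvS hvS' hP
  induction hN : (S \ S').card generalizing S with
  | zero =>
    rw [Finset.card_eq_zero, Finset.sdiff_eq_empty_iff_subset] at hN
    rwa [← Finset.eq_of_subset_of_card_le hN (by omega)]
  | succ N ih =>
    obtain ⟨e, he⟩ : (S \ S').Nonempty := by
      rw [← Finset.card_pos]; omega
    obtain ⟨heS, heS'⟩ := Finset.mem_sdiff.mp he
    have hcard : (S.erase e).card + 1 = d := by rw [Finset.card_erase_add_one heS, hS]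
    obtain ⟨x, hx, hxs⟩ := exists_notMem_span_of_card_lt v (T := S.erase e) hvS' (by omega)
    have hxe : x ∉ S.erase e := fun h => hxs (Submodule.subset_span ⟨x, h, rfl⟩)
    have hxne : x ≠ e := by rintro rfl; exact heS' hx
    have hxS : x ∉ S := fun h => hxe (Finset.mem_erase.mpr ⟨hxne, h⟩)
    have hB : (insert x (S.erase e)).card = d := by
      rw [Finset.card_insert_of_notMem hxe, hcard]
    have hvB : LinearIndepOn ℝ v ↑(insert x (S.erase e)) := by
      rw [Finset.coe_insert]
      exact (hvS.mono (by simp)).insert hxs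
    have hdiff : S \ insert x (S.erase e) = {e} := by
      ext y; simp only [Finset.mem_sdiff, Finset.mem_insert, Finset.mem_erase,
        Finset.mem_singleton]
      grind
    have hdiff' : insert x (S.erase e) \ S' = (S \ S').erase e := by
      ext y; simp only [Finset.mem_sdiff, Finset.mem_insert, Finset.mem_erase]
      grind
    refine ih _ hB hvB (hadj S _ hS hB hvS hvB (by rw [hdiff]; simp) hP) ?_
    rw [hdiff', Finset.card_erase_of_mem he, hN]; rfl

theorem det_of_cons_column {d : ℕ} (y : Fin (d + 1) → ℝ) (A : Matrix (Fin (d + 1)) (Fin d) ℝ) :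
    (Matrix.of fun s => (Fin.cons (y s) (A s) : Fin (d + 1) → ℝ)).det =
      ∑ s : Fin (d + 1), (-1) ^ (s : ℕ) * y s * (A.submatrix s.succAbove id).det := by
  rw [Matrix.det_succ_column_zero]
  rfl

theorem of_cons_column_mulVec {d : ℕ} (y : Fin (d + 1) → ℝ) (A : Matrix (Fin (d + 1)) (Fin d) ℝ)
    (w : Fin (d + 1) → ℝ) (s : Fin (d + 1)) :
    ((Matrix.of fun s => (Fin.cons (y s) (A s) : Fin (d + 1) → ℝ)) *ᵥ w) s =
      y s * w 0 + (A *ᵥ Fin.tail w) s := by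
  simp [Matrix.mulVec, dotProduct, Fin.sum_univ_succ, Fin.tail]

theorem sum_mulVec_mul_minor_eq_zero {d : ℕ} (A : Matrix (Fin (d + 1)) (Fin d) ℝ)
    (α : Fin d → ℝ) :
    ∑ s : Fin (d + 1), (-1) ^ (s : ℕ) * (A *ᵥ α) s * (A.submatrix s.succAbove id).det = 0 := by
  rw [← det_of_cons_column, ← Matrix.exists_mulVec_eq_zero_iff]
  refine ⟨Fin.cons 1 (-α), fun h => by simpa using congrFun h 0, ?_⟩
  ext s
  rw [of_cons_column_mulVec]
  simp [Matrix.mulVec_neg]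

theorem exists_mulVec_eq_of_sum_eq_zero {d : ℕ} (A : Matrix (Fin (d + 1)) (Fin d) ℝ)
    (hA : Function.Injective A.mulVec) (y : Fin (d + 1) → ℝ)
    (h : ∑ s : Fin (d + 1), (-1) ^ (s : ℕ) * y s * (A.submatrix s.succAbove id).det = 0) :
    ∃ α, A *ᵥ α = y := by
  rw [← det_of_cons_column, ← Matrix.exists_mulVec_eq_zero_iff] at h
  obtain ⟨w, hw, hw0⟩ := h
  have key : ∀ s, y s * w 0 + (A *ᵥ Fin.tail w) s = 0 := fun s => by
    rw [← of_cons_column_mulVec, hw0]; rfl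
  have h0 : w 0 ≠ 0 := by
    intro h0
    apply hw
    have : Fin.tail w = 0 := hA (by ext s; simpa [h0] using key s)
    rw [← Fin.cons_self_tail w, this, h0]
    ext i
    induction i using Fin.cases <;> simp
  refine ⟨(-(w 0)⁻¹) • Fin.tail w, ?_⟩
  ext s
  rw [Matrix.mulVec_smul, Pi.smul_apply, smul_eq_mul]
  have := key s
  field_simp
  linarith

theorem exists_cut {n d : ℕ} {g : Fin d → Fin n} (hg : StrictMono g) {r : Fin n}
    (hr : ∀ c, g c ≠ r) :
    ∃ p : Fin (d + 1), ∀ c : Fin d, (c.castSucc < p → g c < r) ∧ (p ≤ c.castSucc → r < g c) := by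
  by_cases h : ∃ c, r < g c
  · obtain ⟨c, hc, hmin⟩ := WellFounded.has_min (wellFounded_lt) {c | r < g c} h
    refine ⟨c.castSucc, fun x => ⟨fun hx => ?_, fun hx => ?_⟩⟩
    · have := fun hh => hmin x hh (by simpa using hx)
      exact lt_of_le_of_ne (not_lt.mp this) (hr x)
    · exact lt_of_lt_of_le hc (hg.monotone (by simpa using hx))
  · push Not at h
    refine ⟨Fin.last d, fun x => ⟨fun _ => lt_of_le_of_ne (h x) (hr x), fun hx => ?_⟩⟩
    exact absurd hx (not_le.mpr (Fin.castSucc_lt_last x))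

theorem prod_sign_cut {d : ℕ} (p : Fin (d + 1)) :
    ∏ c : Fin d, (if c.castSucc < p then (-1 : ℝ) else 1) = (-1) ^ (p : ℕ) := by
  rw [Finset.prod_ite, Finset.prod_const_one, mul_one, Finset.prod_const]
  congr 1
  have : (Finset.univ.filter fun c : Fin d => c.castSucc < p) =
      Finset.univ.filter fun c : Fin d => (c : ℕ) < p := by
    ext c; simp [Fin.lt_def]
  rw [this, Fin.card_filter_val_lt]
  have := p.is_lt
  omega

theorem exists_isUnit_vecMul_eq {d : ℕ} {z e : Fin d → ℝ} (hz : z ≠ 0) (he : e ≠ 0) :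
    ∃ P : Matrix (Fin d) (Fin d) ℝ, IsUnit P ∧ z ᵥ* P = e := by
  obtain ⟨L, hL⟩ := SeparatingDual.exists_continuousLinearEquiv_apply_eq (R := ℝ) hz he
  refine ⟨(LinearMap.toMatrix' (L : (Fin d → ℝ) →ₗ[ℝ] (Fin d → ℝ)))ᵀ, ?_, ?_⟩
  · rw [Matrix.isUnit_transpose, Matrix.isUnit_iff_isUnit_det, LinearMap.det_toMatrix']
    exact L.toLinearEquiv.isUnit_det'
  · rw [Matrix.vecMul_transpose, LinearMap.toMatrix'_mulVec]
    exact hL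

/-- Vectors in the column space of a matrix with `d` independent columns, whose maximal minors
all have the same sign, have fewer than `d` alternations. -/
theorem not_hasAlternations_mulVec {n : ℕ} : ∀ {d : ℕ} (Z : Matrix (Fin n) (Fin d) ℝ)
    (_ : Function.Injective Z.mulVec) (η : ℝ) (_ : η ≠ 0)
    (_ : ∀ f : Fin d → Fin n, StrictMono f → 0 ≤ η * (Z.submatrix f id).det) (α : Fin d → ℝ),
    ¬ HasAlternations (Z *ᵥ α) d := by
  intro d
  induction d with
  | zero =>
    rintro Z - η - - α ⟨F, -, ε, h⟩
    simpa [Matrix.mulVec, dotProduct] using h 0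
  | succ d ih =>
    rintro Z hZ η hη hs α ⟨F, hF, ε, hε⟩
    have hsum := sum_mulVec_mul_minor_eq_zero (Z.submatrix F id) α
    have hterm : ∀ s : Fin (d + 2),
        0 ≤ (ε * (-1) ^ (s : ℕ) * (Z *ᵥ α) (F s)) * (η * (Z.submatrix (F ∘ s.succAbove) id).det) :=
      fun s => mul_nonneg (hε s).le (hs _ (hF.comp (Fin.strictMono_succAbove s)))
    have hzero : ∀ s : Fin (d + 2), (Z.submatrix (F ∘ s.succAbove) id).det = 0 := by
      have h0 : ∑ s : Fin (d + 2),
          (ε * (-1) ^ (s : ℕ) * (Z *ᵥ α) (F s)) * (η * (Z.submatrix (F ∘ s.succAbove) id).det) = 0 := by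
        have := congrArg (fun x => ε * η * x) hsum
        simp only [Finset.mul_sum, mul_zero] at this
        rw [← this]
        refine Finset.sum_congr rfl fun s _ => ?_
        have e1 : (Z.submatrix F id *ᵥ α) s = (Z *ᵥ α) (F s) := rfl
        have e2 : (Z.submatrix F id).submatrix s.succAbove id =
          Z.submatrix (F ∘ s.succAbove) id := rfl
        rw [e1, e2]
        ring
      intro s
      have := (Finset.sum_eq_zero_iff_of_nonneg (fun s _ => hterm s)).mp h0 s (Finset.mem_univ s)
      simpa [(hε s).ne', hη] using this
    -- a vector killed by the chosen rows
    obtain ⟨δ, hδ0, hδ⟩ : ∃ δ : Fin (d + 1) → ℝ, δ ≠ 0 ∧ (Z.submatrix F id) *ᵥ δ = 0 := by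
      by_contra! hcon
      have hinj : Function.Injective (Z.submatrix F id).mulVec := by
        intro a b hab
        by_contra hne
        exact hcon (a - b) (sub_ne_zero.mpr hne) (by rw [Matrix.mulVec_sub]; exact sub_eq_zero.mpr hab)
      obtain ⟨f, hf, hdet⟩ := exists_det_ne_zero_of_injective _ hinj
      have hns : ¬ Function.Surjective f := by
        intro hsurj
        have := Fintype.card_le_of_surjective f hsurj
        simp at this
      obtain ⟨s, hs'⟩ := not_forall.mp hns
      have hfs : f = s.succAbove := by
        obtain ⟨p, hp⟩ := exists_cut hf (r := s) (fun c hc => hs' ⟨c, hc⟩)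
        have h1 : StrictMono (p.insertNth s f : Fin (d + 2) → Fin (d + 2)) := by
          rw [Fin.strictMono_insertNth_iff]
          exact ⟨hf, fun i hi => (hp i).1 hi, fun i hi => (hp i).2 hi⟩
        have h2 : (p.insertNth s f : Fin (d + 2) → Fin (d + 2)) = id := h1.eq_id
        have h3 : s = p := by simpa using congrFun h2 p
        ext1 c
        simpa [h3] using congrFun h2 (p.succAbove c)
      exact hdet (by rw [hfs]; exact hzero s)
    obtain ⟨r, hr⟩ : ∃ r, (Z *ᵥ δ) r ≠ 0 := by
      by_contra! hcon
      exact hδ0 (hZ (by rw [Matrix.mulVec_zero]; ext i; exact hcon i))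
    -- modify the coefficients so that the entry at `r` vanishes
    set β : Fin (d + 1) → ℝ := α - ((Z *ᵥ α) r / (Z *ᵥ δ) r) • δ with hβ
    have hβr : (Z *ᵥ β) r = 0 := by
      rw [hβ, Matrix.mulVec_sub, Matrix.mulVec_smul]
      simp [hr]
    have hβF : ∀ s, (Z *ᵥ β) (F s) = (Z *ᵥ α) (F s) := by
      intro s
      have : (Z *ᵥ δ) (F s) = 0 := congrFun hδ s
      rw [hβ, Matrix.mulVec_sub, Matrix.mulVec_smul]
      simp [this]
    have hFr : ∀ s, F s ≠ r := by
      intro s hsr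
      have h1 := hε s
      rw [← hβF, hsr, hβr] at h1
      simp at h1
    have hZr : Z.row r ≠ 0 := by
      intro h
      apply hr
      change Z.row r ⬝ᵥ δ = 0
      rw [h, zero_dotProduct]
    obtain ⟨P, hP, hPr⟩ := exists_isUnit_vecMul_eq hZr
      (e := (Pi.single 0 1 : Fin (d + 1) → ℝ)) (by simp)
    obtain ⟨Q, hQ⟩ := hP.exists_right_inv
    have hdetP : P.det ≠ 0 := ((Matrix.isUnit_iff_isUnit_det P).mp hP).ne_zero
    set Y := Z * P with hY
    have hYr : ∀ c, Y r c = (Pi.single 0 1 : Fin (d + 1) → ℝ) c := fun c => congrFun hPr c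
    have hYQ : Y *ᵥ (Q *ᵥ β) = Z *ᵥ β := by
      rw [hY, Matrix.mulVec_mulVec, Matrix.mul_assoc, hQ, Matrix.mul_one]
    have hYinj : Function.Injective Y.mulVec := by
      intro a b hab
      rw [hY, ← Matrix.mulVec_mulVec, ← Matrix.mulVec_mulVec] at hab
      exact Matrix.mulVec_injective_of_isUnit hP (hZ hab)
    set γ := Q *ᵥ β with hγ
    have hγ0 : γ 0 = 0 := by
      have : (Y *ᵥ γ) r = 0 := by rw [hYQ, hβr]
      rw [Matrix.mulVec, show (fun j => Y r j) = (Pi.single 0 1 : Fin (d + 1) → ℝ) from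
        funext hYr] at this
      simpa using this
    let σ : Fin n → ℝ := fun i => if i < r then -1 else 1
    have hσ : ∀ i, σ i ≠ 0 := fun i => by simp only [σ]; split_ifs <;> norm_num
    let W : Matrix (Fin n) (Fin d) ℝ := Matrix.of fun i c => σ i * Y i c.succ
    have hW : ∀ (w : Fin (d + 1) → ℝ), w 0 = 0 → ∀ i,
        (W *ᵥ Fin.tail w) i = σ i * (Y *ᵥ w) i := by
      intro w hw i
      simp [W, Matrix.mulVec, dotProduct, Fin.sum_univ_succ, hw, Finset.mul_sum, Fin.tail, mul_assoc]
    refine ih W ?_ (η * P.det⁻¹) (by simp [hη, hdetP]) ?_ (Fin.tail γ) ?_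
    · intro a b hab
      have hab' : W *ᵥ Fin.tail (Fin.cons 0 (a - b) : Fin (d + 1) → ℝ) = 0 := by
        rw [Fin.tail_cons, Matrix.mulVec_sub]; exact sub_eq_zero.mpr hab
      have : Y *ᵥ (Fin.cons 0 (a - b) : Fin (d + 1) → ℝ) = Y *ᵥ 0 := by
        ext i
        have h1 := congrFun hab' i
        rw [hW _ (by simp)] at h1
        simpa [hσ i] using h1
      have h2 := hYinj this
      ext c
      have := congrFun h2 c.succ
      simpa [sub_eq_zero] using this
    · intro h hh
      by_cases hrh : ∃ c, h c = r
      · obtain ⟨c, hc⟩ := hrh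
        rw [Matrix.det_eq_zero_of_row_eq_zero c, mul_zero]
        intro x
        simp [W, hc, hYr]
      · push Not at hrh
        obtain ⟨p, hp⟩ := exists_cut hh hrh
        have hG : StrictMono (p.insertNth r h : Fin (d + 1) → Fin n) := by
          rw [Fin.strictMono_insertNth_iff]
          exact ⟨hh, fun i hi => (hp i).1 hi, fun i hi => (hp i).2 hi⟩
        have h1 : (W.submatrix h id).det = (-1) ^ (p : ℕ) * (Y.submatrix h Fin.succ).det := by
          rw [← prod_sign_cut p, ← Matrix.det_mul_column]
          congr 1
          ext c x
          have : (h c < r) ↔ c.castSucc < p :=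
            ⟨fun hlt => by
              by_contra hcon
              exact absurd hlt (not_lt.mpr ((hp c).2 (not_lt.mp hcon)).le), (hp c).1⟩
          simp [W, σ, this]
        have h2 : (Y.submatrix (p.insertNth r h : Fin (d + 1) → Fin n) id).det =
            (-1) ^ (p : ℕ) * (Y.submatrix h Fin.succ).det := by
          rw [Matrix.det_succ_row _ p, Fin.sum_univ_succ, Finset.sum_eq_zero]
          · have e : (Y.submatrix (p.insertNth r h : Fin (d + 1) → Fin n) id).submatrix
                p.succAbove (Fin.succAbove 0) = Y.submatrix h Fin.succ := by
              ext a b; simp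
            rw [e]
            simp [hYr]
          · intro x _
            simp [hYr]
        have h3 : (Y.submatrix (p.insertNth r h : Fin (d + 1) → Fin n) id).det =
            (Z.submatrix (p.insertNth r h : Fin (d + 1) → Fin n) id).det * P.det := by
          rw [← Matrix.det_mul, hY]
          congr 1
        rw [h1, ← h2, h3]
        have := hs _ hG
        calc 0 ≤ _ := this
          _ = _ := by field_simp
    · obtain ⟨p, hp⟩ := exists_cut (g := fun c : Fin (d + 1) => F c.castSucc)
        (hF.comp Fin.strictMono_castSucc) (r := r) (fun c => hFr _)
      refine ⟨F ∘ p.succAbove, hF.comp (Fin.strictMono_succAbove p), -ε, fun s => ?_⟩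
      rw [hW _ hγ0, hYQ, Function.comp_apply, hβF]
      rcases lt_or_ge s.castSucc p with hlt | hge
      · have h1 := (hp s).1 hlt
        have h2 := hε s.castSucc
        rw [Fin.succAbove_of_castSucc_lt _ _ hlt]
        simp only [σ, if_pos h1]
        rw [Fin.val_castSucc] at h2
        linarith
      · have h1 := (hp s).2 hge
        have h2 := hε s.succ
        have h3 : ¬ F s.succ < r := not_lt.mpr (h1.trans (hF Fin.castSucc_lt_succ)).le
        rw [Fin.succAbove_of_le_castSucc _ _ hge]
        simp only [σ, if_neg h3]
        rw [Fin.val_succ, pow_succ] at h2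
        linarith

theorem det_mul_eq_sum {d m : ℕ} (A : Matrix (Fin d) (Fin m) ℝ) (W : Matrix (Fin m) (Fin d) ℝ) :
    (A * W).det = ∑ g : Fin d → Fin m, (∏ c, W (g c) c) * (A.submatrix id g).det := by
  have h : ((A * W)ᵀ : Matrix (Fin d) (Fin d) ℝ) = fun c => ∑ l : Fin m, W l c • Aᵀ l := by
    ext c i
    simp [Matrix.mul_apply, mul_comm]
  rw [← Matrix.det_transpose, h]
  change Matrix.detRowAlternating.toMultilinearMap (fun c => ∑ l : Fin m, W l c • Aᵀ l) = _
  rw [MultilinearMap.map_sum]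
  refine Finset.sum_congr rfl fun g _ => ?_
  rw [MultilinearMap.map_smul_univ, smul_eq_mul]
  congr 1
  rw [← Matrix.det_transpose]
  rfl

theorem SC.exists_sign {n m d : ℕ} {X : Matrix (Fin n) (Fin m) ℝ} (h : SC X d) :
    ∃ η : ℝ, η ≠ 0 ∧ ∀ (f : Fin d → Fin n) (g : Fin d → Fin m), StrictMono f → StrictMono g →
      0 ≤ η * (X.submatrix f g).det := by
  rcases h with h | h
  · exact ⟨1, one_ne_zero, fun f g hf hg => by simpa using h f g hf hg⟩
  · exact ⟨-1, by norm_num, fun f g hf hg => by simpa using h f g hf hg⟩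

theorem injective_mulVec_of_det_ne_zero {n d : ℕ} {Z : Matrix (Fin n) (Fin d) ℝ}
    {f : Fin d → Fin n} (h : (Z.submatrix f id).det ≠ 0) : Function.Injective Z.mulVec := by
  intro a b hab
  refine Matrix.mulVec_injective_of_isUnit
    ((Matrix.isUnit_iff_isUnit_det (Z.submatrix f id)).mpr h.isUnit) ?_
  ext c
  exact congrFun hab (f c)

theorem injective_mulVec_submatrix {n m d : ℕ} {X : Matrix (Fin n) (Fin m) ℝ} {g : Fin d → Fin m}
    (h : LinearIndependent ℝ (fun i => Xᵀ (g i))) :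
    Function.Injective (X.submatrix id g).mulVec :=
  Matrix.mulVec_injective_iff.mpr h

/-- A matrix that is `(r + 1)`-sign consistent with independent columns does not increase the
variation of a vector with `r + 1` sign blocks. -/
theorem not_hasAlternations_mulVec_of_blocks {n m r : ℕ} (X : Matrix (Fin n) (Fin m) ℝ)
    (hX : SC X (r + 1))
    (hli : ∀ g : Fin (r + 1) → Fin m, StrictMono g → LinearIndependent ℝ (fun i => Xᵀ (g i)))
    {u : Fin m → ℝ} {ε : ℝ} {b : Fin m → ℕ} (hε : ε = 1 ∨ ε = -1) (hb : Monotone b)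
    (hbr : ∀ l, b l ≤ r) (hs : ∀ l, 0 ≤ ε * (-1) ^ b l * u l)
    (hc : ∀ c ≤ r, ∃ l, b l = c ∧ u l ≠ 0) :
    ¬ HasAlternations (X *ᵥ u) (r + 1) := by
  obtain ⟨η, hη, hsign⟩ := hX.exists_sign
  let W : Matrix (Fin m) (Fin (r + 1)) ℝ := Matrix.of fun l c => if b l = c then |u l| else 0
  have hW : ∀ l c, 0 ≤ W l c := fun l c => by
    simp only [W, Matrix.of_apply]; split_ifs <;> positivity
  have hdet : ∀ f : Fin (r + 1) → Fin n, ((X * W).submatrix f id).det =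
      ∑ g : Fin (r + 1) → Fin m, (∏ c, W (g c) c) * (X.submatrix f g).det :=
    fun f => det_mul_eq_sum (X.submatrix f id) W
  have hmono : ∀ g : Fin (r + 1) → Fin m, (∏ c, W (g c) c) ≠ 0 → StrictMono g := by
    intro g hg
    have hbg : ∀ c, b (g c) = c := by
      intro c
      by_contra hne
      exact hg (Finset.prod_eq_zero (Finset.mem_univ c) (by simp [W, hne]))
    intro i j hij
    by_contra hcon
    have := hb (not_lt.mp hcon)
    rw [hbg, hbg] at this
    exact absurd hij (not_lt.mpr this)
  have hterm : ∀ f : Fin (r + 1) → Fin n, StrictMono f → ∀ g : Fin (r + 1) → Fin m,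
      0 ≤ η * ((∏ c, W (g c) c) * (X.submatrix f g).det) := by
    intro f hf g
    by_cases hg : (∏ c, W (g c) c) = 0
    · simp [hg]
    · rw [mul_left_comm]
      exact mul_nonneg (Finset.prod_nonneg fun c _ => hW _ _) (hsign f g hf (hmono g hg))
  choose g hg using fun c : Fin (r + 1) => hc c (by omega)
  have hgpos : (∏ c, W (g c) c) ≠ 0 := by
    rw [Finset.prod_ne_zero_iff]
    intro c _
    simp [W, (hg c).1, (hg c).2]
  obtain ⟨f, hf, hfdet⟩ := exists_det_ne_zero_of_injective _
    (injective_mulVec_submatrix (hli g (hmono g hgpos)))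
  have hinj : Function.Injective (X * W).mulVec := by
    apply injective_mulVec_of_det_ne_zero (f := f)
    intro h0
    have h1 : ∑ g : Fin (r + 1) → Fin m, η * ((∏ c, W (g c) c) * (X.submatrix f g).det) = 0 := by
      rw [← Finset.mul_sum, ← hdet, h0, mul_zero]
    have h2 := (Finset.sum_eq_zero_iff_of_nonneg (fun g _ => hterm f hf g)).mp h1 g
      (Finset.mem_univ g)
    exact mul_ne_zero hη (mul_ne_zero hgpos hfdet) h2
  have hXu : X *ᵥ u = (X * W) *ᵥ (fun c : Fin (r + 1) => ε * (-1) ^ (c : ℕ)) := by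
    rw [← Matrix.mulVec_mulVec]
    congr 1
    ext l
    have hl : b l < r + 1 := Nat.lt_succ_of_le (hbr l)
    rw [Matrix.mulVec, dotProduct, Finset.sum_eq_single (⟨b l, hl⟩ : Fin (r + 1))]
    · have habs : |u l| = ε * (-1) ^ b l * u l := by
        rw [← abs_of_nonneg (hs l), abs_mul, abs_mul]
        rcases hε with rfl | rfl <;> simp
      have e2 : ((-1 : ℝ) ^ b l) * (-1) ^ b l = 1 := by rw [← mul_pow]; simp
      have e3 : ε * ε = 1 := by rcases hε with rfl | rfl <;> simp
      simp only [W, Matrix.of_apply, if_true, habs]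
      calc u l = (ε * ε) * (((-1 : ℝ) ^ b l) * (-1) ^ b l) * u l := by rw [e2, e3]; ring
        _ = _ := by ring
    · intro c _ hne
      have : b l ≠ c := fun h => hne (Fin.ext h.symm)
      simp [W, this]
    · simp
  rw [hXu]
  refine not_hasAlternations_mulVec _ hinj η hη (fun f hf => ?_) _
  rw [hdet, Finset.mul_sum]
  exact Finset.sum_nonneg fun g _ => hterm f hf g

theorem SR.VD {n m k : ℕ} {X : Matrix (Fin n) (Fin m) ℝ} (hX : SR X k) (hk : 1 ≤ k)
    (hli : ∀ j ≤ k, ∀ g : Fin j → Fin m, StrictMono g → LinearIndependent ℝ (fun i => Xᵀ (g i))) :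
    VD X (k - 1) := by
  intro j hj u hu hvar
  obtain ⟨r, ε, b, hε, hb, hbr, hs, hc, x, t, hxt, -, hsc⟩ := exists_sign_blocks u hu
  have hvr : variation u = r := by
    simp only [variation, hxt, hsc]
    simp
  have hrj : r ≤ j := by rw [hvr] at hvar; exact_mod_cast hvar
  have := not_hasAlternations_mulVec_of_blocks X (hX (r + 1) (by omega) (by omega))
    (hli (r + 1) (by omega)) hε hb hbr hs hc
  rw [← le_variation_iff] at this
  push_cast at this
  omega

theorem exists_pos_weights_sum_eq_zero {ι : Type*} [Fintype ι] [DecidableEq ι] (D : ι → ℝ)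
    {s t : ι} (hs : 0 < D s) (ht : D t < 0) :
    ∃ p : ι → ℝ, (∀ i, 0 < p i) ∧ ∑ i, p i * D i = 0 := by
  have key : ∀ (e : ι) (x : ℝ), 0 ≤ x → x * D e = -∑ i, D i →
      ∃ p : ι → ℝ, (∀ i, 0 < p i) ∧ ∑ i, p i * D i = 0 := by
    intro e x hx he
    refine ⟨fun i => 1 + if i = e then x else 0, fun i => ?_, ?_⟩
    · dsimp only
      split_ifs <;> linarith
    · simp [add_mul, Finset.sum_add_distrib, he]
  rcases le_total 0 (∑ i, D i) with h | h
  · refine key t ((∑ i, D i) / (-D t)) (div_nonneg h (by linarith)) ?_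
    have := ht.ne
    field_simp
  · refine key s ((-∑ i, D i) / D s) (div_nonneg (by linarith) hs.le) ?_
    have := hs.ne'
    field_simp

theorem not_opposite_minors {n d : ℕ} (Y : Matrix (Fin n) (Fin d) ℝ)
    (h : ∀ α, ¬ HasAlternations (Y *ᵥ α) d) {F : Fin (d + 1) → Fin n} (hF : StrictMono F)
    {s t : Fin (d + 1)} (hs : 0 < (Y.submatrix (F ∘ s.succAbove) id).det)
    (ht : (Y.submatrix (F ∘ t.succAbove) id).det < 0) : False := by
  obtain ⟨p, hp, hsum⟩ := exists_pos_weights_sum_eq_zero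
    (fun i : Fin (d + 1) => (Y.submatrix (F ∘ i.succAbove) id).det) hs ht
  have hinj : Function.Injective (Y.submatrix F id).mulVec :=
    injective_mulVec_of_det_ne_zero (f := s.succAbove) hs.ne'
  have hsq : ∀ i : Fin (d + 1), ((-1 : ℝ) ^ (i : ℕ)) * (-1) ^ (i : ℕ) = 1 := fun i => by
    rw [← mul_pow]; simp
  obtain ⟨α, hα⟩ := exists_mulVec_eq_of_sum_eq_zero _ hinj (fun i => (-1) ^ (i : ℕ) * p i) (by
    rw [← hsum]
    refine Finset.sum_congr rfl fun i _ => ?_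
    rw [← mul_assoc, hsq, one_mul]
    rfl)
  refine h α ⟨F, hF, 1, fun i => ?_⟩
  have : (Y *ᵥ α) (F i) = (-1) ^ (i : ℕ) * p i := congrFun hα i
  rw [this, one_mul, ← mul_assoc, hsq, one_mul]
  exact hp i

/-- If no vector in the column space of a matrix with `d` independent columns has `d`
alternations, then its maximal minors all have the same sign. -/
theorem minors_same_sign_of_not_hasAlternations {n d : ℕ} (Y : Matrix (Fin n) (Fin d) ℝ)
    (h : ∀ α, ¬ HasAlternations (Y *ᵥ α) d) :
    (∀ f : Fin d → Fin n, StrictMono f → 0 ≤ (Y.submatrix f id).det) ∨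
      (∀ f : Fin d → Fin n, StrictMono f → (Y.submatrix f id).det ≤ 0) := by
  by_contra! hcon
  obtain ⟨⟨f, hf, hfneg⟩, g, hg, hgpos⟩ := hcon
  obtain ⟨S, hS, rfl⟩ := eq_orderEmbOfFin_of_strictMono hf
  obtain ⟨T, hT, rfl⟩ := eq_orderEmbOfFin_of_strictMono hg
  have hpos := of_exchange_of_linearIndepOn Y.row d
    (fun S => ∀ h : S.card = d, 0 < (Y.submatrix (S.orderEmbOfFin h) id).det) ?_ T S hT hS
    ((linearIndepOn_row_iff_det_ne_zero Y T hT).mpr hgpos.ne')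
    ((linearIndepOn_row_iff_det_ne_zero Y S hS).mpr hfneg.ne) (fun _ => hgpos) hS
  · exact lt_asymm hpos hfneg
  clear hfneg hgpos hf hg hS hT
  clear S T
  intro S S' hS hS' hvS hvS' hcard hP hS''
  obtain ⟨e, he⟩ := Finset.card_eq_one.mp hcard
  have hcard' : (S' \ S).card = 1 := by
    rw [← hcard]; exact Finset.card_sdiff_comm (hS'.trans hS.symm)
  obtain ⟨e', he'⟩ := Finset.card_eq_one.mp hcard'
  have heS : e ∈ S ∧ e ∉ S' := by
    rw [← Finset.mem_sdiff, he]; simp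
  have heS' : e' ∈ S' ∧ e' ∉ S := by
    rw [← Finset.mem_sdiff, he']; simp
  have hU : (insert e' S).card = d + 1 := by
    rw [Finset.card_insert_of_notMem heS'.2, hS]
  have h1 : S = (insert e' S).erase e' := by rw [Finset.erase_insert heS'.2]
  have h2 : S' = (insert e' S).erase e := by
    ext x
    have hx := Finset.ext_iff.mp he x
    have hx' := Finset.ext_iff.mp he' x
    simp only [Finset.mem_sdiff, Finset.mem_singleton] at hx hx'
    simp only [Finset.mem_erase, Finset.mem_insert]
    grind
  obtain ⟨s, hs⟩ := orderEmbOfFin_erase hU (Finset.mem_insert_self e' S) (by rw [← h1, hS])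
  obtain ⟨t, ht⟩ := orderEmbOfFin_erase hU (Finset.mem_insert_of_mem heS.1) (by rw [← h2, hS'])
  have hs' : ⇑(S.orderEmbOfFin hS) = (insert e' S).orderEmbOfFin hU ∘ s.succAbove := by
    ext1 c
    rw [Function.comp_apply, ← hs]
    congr!
  have ht' : ⇑(S'.orderEmbOfFin hS') = (insert e' S).orderEmbOfFin hU ∘ t.succAbove := by
    ext1 c
    rw [Function.comp_apply, ← ht]
    congr!
  by_contra hneg
  have hne := (linearIndepOn_row_iff_det_ne_zero Y S' hS').mp hvS'
  have hlt := lt_of_le_of_ne (not_lt.mp hneg) hne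
  have hgt := hP hS
  rw [hs'] at hgt
  rw [ht'] at hlt
  exact not_opposite_minors Y h (OrderEmbedding.strictMono _) hgt hlt

theorem false_of_combinations {ι : Type*} {A B : ι → ℝ}
    (H : ∀ a b : ℝ, 0 ≤ a → 0 ≤ b → (a ≠ 0 ∨ b ≠ 0) →
      ((∀ i, 0 ≤ a * A i + b * B i) ∨ (∀ i, a * A i + b * B i ≤ 0)) ∧ ∃ i, a * A i + b * B i ≠ 0)
    (hA : ∀ i, 0 ≤ A i) (hB : ∀ i, B i ≤ 0) : False := by
  obtain ⟨i, hi⟩ := (H 1 0 zero_le_one le_rfl (Or.inl one_ne_zero)).2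
  obtain ⟨j, hj⟩ := (H 0 1 le_rfl zero_le_one (Or.inr one_ne_zero)).2
  have hAi : 0 < A i := lt_of_le_of_ne (hA i) (by simpa [eq_comm] using hi)
  have hBj : B j < 0 := lt_of_le_of_ne (hB j) (by simpa using hj)
  rcases (hB i).eq_or_lt with hBi | hBi
  · rcases (H (-B j) (A j + 1) (by linarith) (by linarith [hA j]) (Or.inl (by linarith))).1 with h | h
    · nlinarith [h j]
    · have := h i
      rw [hBi] at this
      nlinarith
  · obtain ⟨l, hl⟩ := (H (-B i) (A i) (by linarith) hAi.le (Or.inr hAi.ne')).2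
    rcases lt_or_gt_of_ne hl with hl | hl
    · set v := -(-B i * A l + A i * B l) with hv
      have hx : 0 < v / (1 + A l) := div_pos (by linarith) (by linarith [hA l])
      have hxe : v / (1 + A l) * (1 + A l) = v := div_mul_cancel₀ _ (by linarith [hA l])
      rcases (H (-B i + v / (1 + A l)) (A i) (by linarith) hAi.le (Or.inr hAi.ne')).1 with h | h
      · have := h l
        nlinarith
      · have := h i
        nlinarith [mul_pos hx hAi]
    · set v := -B i * A l + A i * B l with hv
      have hx : 0 < v / (1 - B l) := div_pos hl (by linarith [hB l])
      have hxe : v / (1 - B l) * (1 - B l) = v := div_mul_cancel₀ _ (by linarith [hB l])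
      rcases (H (-B i) (A i + v / (1 - B l)) (by linarith) (by linarith)
        (Or.inl (by linarith))).1 with h | h
      · have := h i
        nlinarith [mul_neg_of_pos_of_neg hx hBi]
      · have := h l
        nlinarith

/-- If all nonnegative combinations of two functions are nonzero and of constant sign, then the
two functions have the same sign. -/
theorem same_sign_of_combinations {ι : Type*} {A B : ι → ℝ}
    (H : ∀ a b : ℝ, 0 ≤ a → 0 ≤ b → (a ≠ 0 ∨ b ≠ 0) →
      ((∀ i, 0 ≤ a * A i + b * B i) ∨ (∀ i, a * A i + b * B i ≤ 0)) ∧ ∃ i, a * A i + b * B i ≠ 0) :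
    ((∀ i, 0 ≤ A i) ∧ ∀ i, 0 ≤ B i) ∨ ((∀ i, A i ≤ 0) ∧ ∀ i, B i ≤ 0) := by
  have hA := (H 1 0 zero_le_one le_rfl (Or.inl one_ne_zero)).1
  have hB := (H 0 1 le_rfl zero_le_one (Or.inr one_ne_zero)).1
  simp only [one_mul, zero_mul, add_zero, zero_add] at hA hB
  rcases hA with hA | hA <;> rcases hB with hB | hB
  · exact Or.inl ⟨hA, hB⟩
  · exact (false_of_combinations H hA hB).elim
  · refine (false_of_combinations (A := B) (B := A) (fun a b ha hb hab => ?_) hB hA).elim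
    simpa only [add_comm] using H b a hb ha hab.symm
  · exact Or.inr ⟨hA, hB⟩

/-- The matrix obtained by merging columns `p` and `p + 1` with weights `b` and `a`. -/
def mergeCols {n d : ℕ} (Y : Matrix (Fin n) (Fin (d + 1)) ℝ) (p : Fin d) (a b : ℝ) :
    Matrix (Fin n) (Fin d) ℝ :=
  Matrix.of fun i c => (if c = p then a else 1) * Y i (p.castSucc.succAbove c) +
    if c = p then b * Y i p.castSucc else 0

theorem det_mergeCols {n d : ℕ} (Y : Matrix (Fin n) (Fin (d + 1)) ℝ) (p : Fin d) (a b : ℝ)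
    (f : Fin d → Fin n) :
    ((mergeCols Y p a b).submatrix f id).det =
      a * (Y.submatrix f p.castSucc.succAbove).det + b * (Y.submatrix f p.succ.succAbove).det := by
  have h1 : (mergeCols Y p a b).submatrix f id =
      (Y.submatrix f p.castSucc.succAbove).updateCol p
        (a • (fun i => Y (f i) (p.castSucc.succAbove p)) + b • fun i => Y (f i) p.castSucc) := by
    ext i c
    by_cases hc : c = p
    · subst hc; simp [mergeCols]
    · simp [mergeCols, hc]
  have h2 : (Y.submatrix f p.castSucc.succAbove).updateCol p
      (fun i => Y (f i) (p.castSucc.succAbove p)) = Y.submatrix f p.castSucc.succAbove := by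
    ext i c
    by_cases hc : c = p
    · subst hc; simp
    · simp [hc]
  have h3 : (Y.submatrix f p.castSucc.succAbove).updateCol p
      (fun i => Y (f i) p.castSucc) = Y.submatrix f p.succ.succAbove := by
    ext i c
    by_cases hc : c = p
    · subst hc; simp
    · have : p.castSucc.succAbove c = p.succ.succAbove c := by
        have hc' : (c : ℕ) ≠ p := fun h => hc (Fin.ext h)
        simp only [Fin.succAbove, Fin.lt_def, Fin.val_castSucc, Fin.val_succ]
        split_ifs <;> first | rfl | omega
      simp [hc, this]
  rw [h1, Matrix.det_updateCol_add, Matrix.det_updateCol_smul, Matrix.det_updateCol_smul, h2, h3]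

theorem mergeCols_mulVec {n d : ℕ} (Y : Matrix (Fin n) (Fin (d + 1)) ℝ) (p : Fin d) (a b : ℝ)
    (α : Fin d → ℝ) :
    mergeCols Y p a b *ᵥ α =
      Y *ᵥ (p.castSucc.insertNth (b * α p) fun c => (if c = p then a else 1) * α c) := by
  ext i
  simp only [Matrix.mulVec, dotProduct]
  rw [Fin.sum_univ_succAbove _ p.castSucc]
  simp only [mergeCols, Matrix.of_apply, Fin.insertNth_apply_same, Fin.insertNth_apply_succAbove,
    add_mul, Finset.sum_add_distrib, ite_mul, zero_mul, Finset.sum_ite_eq', Finset.mem_univ, if_true]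
  rw [add_comm]
  congr 1
  · ring
  · refine Finset.sum_congr rfl fun c _ => ?_
    split_ifs <;> ring

theorem minors_succAbove_same_sign {n d : ℕ} (Y : Matrix (Fin n) (Fin (d + 1)) ℝ)
    (hY : Function.Injective Y.mulVec)
    (h : ∀ u, ¬ HasAlternations u d → ¬ HasAlternations (Y *ᵥ u) d) (p : Fin d) :
    ((∀ f : Fin d → Fin n, StrictMono f → 0 ≤ (Y.submatrix f p.castSucc.succAbove).det) ∧
      ∀ f : Fin d → Fin n, StrictMono f → 0 ≤ (Y.submatrix f p.succ.succAbove).det) ∨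
    ((∀ f : Fin d → Fin n, StrictMono f → (Y.submatrix f p.castSucc.succAbove).det ≤ 0) ∧
      ∀ f : Fin d → Fin n, StrictMono f → (Y.submatrix f p.succ.succAbove).det ≤ 0) := by
  have key := same_sign_of_combinations (ι := {f : Fin d → Fin n // StrictMono f})
    (A := fun f => (Y.submatrix f.1 p.castSucc.succAbove).det)
    (B := fun f => (Y.submatrix f.1 p.succ.succAbove).det) ?_
  · simpa only [Subtype.forall] using key
  intro a b ha hb hab
  simp only [← det_mergeCols]
  have halt : ∀ α, ¬ HasAlternations (mergeCols Y p a b *ᵥ α) d := by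
    intro α
    rw [mergeCols_mulVec]
    apply h
    rintro ⟨F, hF, ε, hε⟩
    have hid : F = id := hF.eq_id
    subst hid
    have h1 := hε p.castSucc
    have h2 := hε p.succ
    rw [id, Fin.insertNth_apply_same, Fin.val_castSucc] at h1
    rw [id, ← Fin.succAbove_castSucc_self, Fin.insertNth_apply_succAbove, if_pos rfl,
      Fin.succAbove_castSucc_self, Fin.val_succ, pow_succ] at h2
    have h3 := mul_pos h1 h2
    have h4 : 0 ≤ (ε * (-1) ^ (p : ℕ) * α p) ^ 2 * (a * b) := by positivity
    nlinarith
  have hinj : Function.Injective (mergeCols Y p a b).mulVec := by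
    intro x y hxy
    rw [mergeCols_mulVec, mergeCols_mulVec] at hxy
    have h1 := hY hxy
    have hsucc : ∀ c, (if c = p then a else 1) * x c = (if c = p then a else 1) * y c := by
      intro c
      simpa using congrFun h1 (p.castSucc.succAbove c)
    have hp : b * x p = b * y p := by simpa using congrFun h1 p.castSucc
    ext c
    by_cases hc : c = p
    · have := hsucc c
      rw [if_pos hc] at this
      subst hc
      rcases hab with h0 | h0
      · exact mul_left_cancel₀ h0 this
      · exact mul_left_cancel₀ h0 hp
    · simpa [hc] using hsucc c
  refine ⟨?_, ?_⟩
  · simpa only [Subtype.forall] using minors_same_sign_of_not_hasAlternations _ halt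
  · obtain ⟨f, hf, hdet⟩ := exists_det_ne_zero_of_injective _ hinj
    exact ⟨⟨f, hf⟩, hdet⟩

theorem all_minors_same_sign {n d : ℕ} (Y : Matrix (Fin n) (Fin (d + 2)) ℝ)
    (hY : Function.Injective Y.mulVec)
    (h : ∀ u, ¬ HasAlternations u (d + 1) → ¬ HasAlternations (Y *ᵥ u) (d + 1)) :
    (∀ (p : Fin (d + 2)) (f : Fin (d + 1) → Fin n), StrictMono f →
      0 ≤ (Y.submatrix f p.succAbove).det) ∨
    (∀ (p : Fin (d + 2)) (f : Fin (d + 1) → Fin n), StrictMono f →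
      (Y.submatrix f p.succAbove).det ≤ 0) := by
  have hstep := minors_succAbove_same_sign Y hY h
  have hne : ∀ p : Fin (d + 2), ∃ f : Fin (d + 1) → Fin n, StrictMono f ∧
      (Y.submatrix f p.succAbove).det ≠ 0 := by
    intro p
    apply exists_det_ne_zero_of_injective (Y.submatrix id p.succAbove)
    have := Matrix.mulVec_injective_iff.mp hY
    exact Matrix.mulVec_injective_iff.mpr (this.comp _ Fin.succAbove_right_injective)
  rcases hstep 0 with h0 | h0
  · left
    intro p
    induction p using Fin.induction with
    | zero => exact h0.1
    | succ i ih =>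
      rcases hstep i with hi | hi
      · exact hi.2
      · obtain ⟨f, hf, hdet⟩ := hne i.castSucc
        exact absurd (le_antisymm (hi.1 f hf) (ih f hf)) hdet
  · right
    intro p
    induction p using Fin.induction with
    | zero => exact h0.1
    | succ i ih =>
      rcases hstep i with hi | hi
      · obtain ⟨f, hf, hdet⟩ := hne i.castSucc
        exact absurd (le_antisymm (ih f hf) (hi.1 f hf)) hdet
      · exact hi.2

theorem HasAlternations.of_extend {N M d : ℕ} {g : Fin N → Fin M} (hg : StrictMono g)
    {u : Fin N → ℝ} (h : HasAlternations (Function.extend g u 0) d) : HasAlternations u d := by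
  obtain ⟨f, hf, ε, hε⟩ := h
  have hrange : ∀ s, ∃ i, g i = f s := by
    intro s
    by_contra hs
    have := hε s
    rw [Function.extend_apply' _ _ _ hs] at this
    simp at this
  choose f' hf' using hrange
  refine ⟨f', fun a b hab => hg.lt_iff_lt.mp ?_, ε, fun s => ?_⟩
  · rw [hf', hf']
    exact hf hab
  · have := hε s
    rwa [← hf', hg.injective.extend_apply] at this

theorem mulVec_submatrix_eq_mulVec_extend {n m d : ℕ} (X : Matrix (Fin n) (Fin m) ℝ)
    {g : Fin d → Fin m} (hg : Function.Injective g) (u : Fin d → ℝ) :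
    X.submatrix id g *ᵥ u = X *ᵥ Function.extend g u 0 := by
  ext i
  simp only [Matrix.mulVec, dotProduct, Matrix.submatrix_apply, id]
  rw [← Finset.sum_subset (Finset.subset_univ (Finset.univ.map ⟨g, hg⟩))]
  · simp [hg.extend_apply]
  · intro l _ hl
    rw [Function.extend_apply' _ _ _ (by simpa using hl)]
    simp

theorem VB.not_hasAlternations_mulVec {n m d : ℕ} {X : Matrix (Fin n) (Fin m) ℝ} (h : VB X d)
    (u : Fin m → ℝ) (hu : ¬ HasAlternations u (d + 1)) : ¬ HasAlternations (X *ᵥ u) (d + 1) := by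
  rcases eq_or_ne u 0 with rfl | h0
  · rw [Matrix.mulVec_zero]
    exact not_hasAlternations_zero
  · rw [← le_variation_iff] at hu ⊢
    push_cast at hu ⊢
    have := h u h0 (by omega)
    omega

theorem VB.minors_same_sign {n m d : ℕ} {X : Matrix (Fin n) (Fin m) ℝ} (h : VB X d)
    {R : Finset (Fin m)} (hR : R.card = d + 2) (hli : LinearIndepOn ℝ Xᵀ ↑R) :
    (∀ (p : Fin (d + 2)) (f : Fin (d + 1) → Fin n), StrictMono f →
      0 ≤ (X.submatrix f (R.orderEmbOfFin hR ∘ p.succAbove)).det) ∨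
    (∀ (p : Fin (d + 2)) (f : Fin (d + 1) → Fin n), StrictMono f →
      (X.submatrix f (R.orderEmbOfFin hR ∘ p.succAbove)).det ≤ 0) := by
  have hmono : StrictMono (R.orderEmbOfFin hR) := (R.orderEmbOfFin hR).strictMono
  refine all_minors_same_sign (X.submatrix id (R.orderEmbOfFin hR))
    (injective_mulVec_submatrix ((linearIndepOn_iff_orderEmbOfFin _ R hR).mp hli)) fun u hu => ?_
  rw [mulVec_submatrix_eq_mulVec_extend X hmono.injective]
  exact h.not_hasAlternations_mulVec _ fun hext => hu (hext.of_extend hmono)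

theorem Matrix.exists_linearIndepOn_insert {n m : ℕ} (X : Matrix (Fin n) (Fin m) ℝ)
    {T : Finset (Fin m)} (hT : LinearIndepOn ℝ Xᵀ ↑T) (hrk : T.card < X.rank) :
    ∃ q ∉ T, LinearIndepOn ℝ Xᵀ ↑(insert q T) := by
  obtain ⟨q, hq⟩ : ∃ q, Xᵀ q ∉ Submodule.span ℝ (Xᵀ '' ↑T) := by
    by_contra! hcon
    have hle : Submodule.span ℝ (Set.range X.col) ≤ Submodule.span ℝ (Xᵀ '' ↑T) := by
      rw [Submodule.span_le]
      rintro _ ⟨q, rfl⟩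
      exact hcon q
    have h1 := Submodule.finrank_mono hle
    rw [← Matrix.rank_eq_finrank_span_cols] at h1
    classical
    have h2 : Module.finrank ℝ (Submodule.span ℝ (X.col '' ↑T)) ≤ T.card := by
      rw [← Finset.coe_image]
      exact (finrank_span_finset_le_card (R := ℝ) (T.image X.col)).trans Finset.card_image_le
    change X.rank ≤ Module.finrank ℝ (Submodule.span ℝ (X.col '' ↑T)) at h1
    omega
  refine ⟨q, fun hqT => hq (Submodule.subset_span ⟨q, hqT, rfl⟩), ?_⟩
  rw [Finset.coe_insert]
  exact hT.insert hq

theorem VB.sc {n m d : ℕ} {X : Matrix (Fin n) (Fin m) ℝ} (h : VB X d) (hrk : d + 1 < X.rank)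
    (hli : ∀ T : Finset (Fin m), T.card = d + 1 → LinearIndepOn ℝ Xᵀ ↑T) : SC X (d + 1) := by
  have herase : ∀ {R : Finset (Fin m)} (hR : R.card = d + 2) {e : Fin m} (_ : e ∈ R)
      {T : Finset (Fin m)} (_ : R.erase e = T) (hT : T.card = d + 1),
      ∃ p : Fin (d + 2), R.orderEmbOfFin hR ∘ p.succAbove = T.orderEmbOfFin hT := by
    rintro R hR e he T rfl hT
    obtain ⟨p, hp⟩ := orderEmbOfFin_erase hR he hT
    exact ⟨p, funext fun c => (hp c).symm⟩
  have hsup : ∀ g : Fin (d + 1) → Fin m, StrictMono g → ∃ (R : Finset (Fin m))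
      (hR : R.card = d + 2) (p : Fin (d + 2)), LinearIndepOn ℝ Xᵀ ↑R ∧
        R.orderEmbOfFin hR ∘ p.succAbove = g := by
    intro g hg
    obtain ⟨T, hT, rfl⟩ := eq_orderEmbOfFin_of_strictMono hg
    obtain ⟨q, hq, hR⟩ := X.exists_linearIndepOn_insert (hli T hT) (by omega)
    have hcard : (insert q T).card = d + 2 := by rw [Finset.card_insert_of_notMem hq, hT]
    obtain ⟨p, hp⟩ := herase hcard (Finset.mem_insert_self q T) (Finset.erase_insert hq) hT
    exact ⟨_, hcard, p, hR, hp⟩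
  let P : Finset (Fin m) → Prop := fun R => ∀ (hR : R.card = d + 2) (p : Fin (d + 2))
    (f : Fin (d + 1) → Fin n), StrictMono f →
      0 ≤ (X.submatrix f (R.orderEmbOfFin hR ∘ p.succAbove)).det
  have hP := of_exchange_of_linearIndepOn Xᵀ (d + 2) P (by
    intro S S' hS hS' _ hliS' hdiff hPS
    have hdiff' : (S' \ S).card = 1 := by
      have h1 := Finset.card_sdiff_add_card_inter S S'
      have h2 := Finset.card_sdiff_add_card_inter S' S
      rw [Finset.inter_comm] at h2
      omega
    have herase_inter : ∀ {A B : Finset (Fin m)}, (A \ B).card = 1 →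
        ∃ e ∈ A, A.erase e = A ∩ B := by
      intro A B hAB
      obtain ⟨e, he⟩ := Finset.card_eq_one.mp hAB
      have hmem : ∀ x, x ∈ A ∧ x ∉ B ↔ x = e := fun x => by
        rw [← Finset.mem_sdiff, he, Finset.mem_singleton]
      refine ⟨e, ((hmem e).mpr rfl).1, ?_⟩
      ext x
      have := hmem x
      simp only [Finset.mem_erase, Finset.mem_inter]
      tauto
    obtain ⟨e, he, heT⟩ := herase_inter hdiff
    obtain ⟨e', he', heT'⟩ := herase_inter hdiff'
    rw [Finset.inter_comm] at heT'
    have hT : (S ∩ S').card = d + 1 := by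
      rw [← heT, Finset.card_erase_of_mem he, hS]; rfl
    obtain ⟨p, hp⟩ := herase hS he heT hT
    obtain ⟨p', hp'⟩ := herase hS' he' heT' hT
    obtain ⟨f, hf, hdet⟩ := exists_det_ne_zero_of_injective
      (X.submatrix id ((S ∩ S').orderEmbOfFin hT))
      (injective_mulVec_submatrix ((linearIndepOn_iff_orderEmbOfFin _ _ hT).mp (hli _ hT)))
    rcases h.minors_same_sign hS' hliS' with hpos | hneg
    · exact fun _ => hpos
    · have h1 := hPS hS p f hf
      have h2 := hneg p' f hf
      rw [hp] at h1
      rw [hp'] at h2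
      exact absurd (le_antisymm h2 h1) hdet)
  by_cases hex : ∃ R : Finset (Fin m), R.card = d + 2 ∧ LinearIndepOn ℝ Xᵀ ↑R ∧ P R
  · obtain ⟨R₀, hR₀, hli₀, hP₀⟩ := hex
    left
    intro f g hf hg
    obtain ⟨R, hR, p, hliR, rfl⟩ := hsup g hg
    exact hP R₀ R hR₀ hR hli₀ hliR hP₀ hR p f hf
  · right
    intro f g hf hg
    obtain ⟨R, hR, p, hliR, rfl⟩ := hsup g hg
    rcases h.minors_same_sign hR hliR with hpos | hneg
    · exact absurd ⟨R, hR, hliR, fun _ => hpos⟩ hex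
    · exact hneg p f hf

theorem linearIndepOn_of_card_le {n m k : ℕ} {X : Matrix (Fin n) (Fin m) ℝ} (hkm : k ≤ m)
    (hli : ∀ g : Fin k → Fin m, Function.Injective g →
      LinearIndependent ℝ (fun i : Fin k => X.transpose (g i)))
    {T : Finset (Fin m)} (hT : T.card ≤ k) : LinearIndepOn ℝ Xᵀ ↑T := by
  obtain ⟨S, hTS, hS⟩ := Finset.exists_superset_card_eq hT (by simpa using hkm)
  refine ((linearIndepOn_iff_orderEmbOfFin Xᵀ S hS).mpr ?_).mono (Finset.coe_subset.mpr hTS)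
  exact hli _ (S.orderEmbOfFin hS).injective

/-- if `rank X > k` and every `k` columns of `X` are linearly independent,
then `X` is `(k-1)`-variation diminishing iff `X` is `k`-sign regular. -/
theorem stmt13 {n m : ℕ} (X : Matrix (Fin n) (Fin m) ℝ) (k : ℕ)
    (hk : 1 ≤ k) (hkrk : k < X.rank)
    (hli : ∀ g : Fin k → Fin m, Function.Injective g →
      LinearIndependent ℝ (fun i : Fin k => X.transpose (g i))) :
    VD X (k - 1) ↔ SR X k := by
  have hkm : k ≤ m := hkrk.le.trans (by simpa using X.rank_le_width)
  constructor
  · intro h j hj1 hjk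
    obtain ⟨d, rfl⟩ := Nat.exists_eq_add_of_le' hj1
    exact (h d (by omega)).sc (by omega) fun T hT =>
      linearIndepOn_of_card_le hkm hli (hT.trans_le hjk)
  · intro h
    refine SR.VD h hk fun j hj g hg => ?_
    obtain ⟨T, hT, rfl⟩ := eq_orderEmbOfFin_of_strictMono hg
    exact (linearIndepOn_iff_orderEmbOfFin Xᵀ T hT).mp
      (linearIndepOn_of_card_le hkm hli (hT.trans_le hj))
end

section
/- Let X be a real n×m matrix with n > m and let k ≤ m. Then X is strictly k-sign consistent if and only if there exists ε ∈ {−1,+1} such that ε·det(X_{α,β}) > 0 for all α = {1,…,k−r} ∪ {t,…,t+r−1} with r ∈ {1,…,k} and t ∈ {k−r+1,…,n−r+1}, and all β = {1,…,k−r̄} ∪ {t̄,…,t̄+r̄−1} with r̄ ∈ {1,…,k} and t̄ ∈ {k−r̄+1,…,m−r̄+1}. -/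
open Matrix Polynomial Filter

/-- Three-term Plücker relation for determinants whose rows after the first two are fixed. -/
lemma det_vecCons_plucker {K : ℕ} (s : Fin K → Fin (K + 2) → ℝ) (x a p d : Fin (K + 2) → ℝ)
    (h : (of (vecCons x (vecCons p s))).det ≠ 0) :
    (of (vecCons x (vecCons p s))).det * (of (vecCons a (vecCons d s))).det =
      (of (vecCons x (vecCons a s))).det * (of (vecCons p (vecCons d s))).det +
      (of (vecCons x (vecCons d s))).det * (of (vecCons a (vecCons p s))).det := by
  let F : (Fin (K + 2) → ℝ) [⋀^Fin (K + 2)]→ₗ[ℝ] ℝ := detRowAlternating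
  let B : (Fin (K + 2) → ℝ) → (Fin (K + 2) → ℝ) → ℝ := fun y z =>
    ((F.curryLeft y).curryLeft z) s
  have hB (y z) : (of (vecCons y (vecCons z s))).det = B y z := rfl
  have hself (y) : B y y = 0 :=
    F.map_eq_zero_of_eq (vecCons y (vecCons y s)) (i := 0) (j := 1) rfl (by simp)
  have hleft (i z) : B (s i) z = 0 :=
    F.map_eq_zero_of_eq (vecCons (s i) (vecCons z s)) (i := 0) (j := i.succ.succ) rfl
      (Fin.succ_ne_zero _).symm
  have hright (i y) : B y (s i) = 0 :=
    F.map_eq_zero_of_eq (vecCons y (vecCons (s i) s)) (i := 1) (j := i.succ.succ) rfl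
      (by simp [Fin.ext_iff])
  have hadd_left (u v z) : B (u + v) z = B u z + B v z := by
    simp [B, -AlternatingMap.curryLeft_apply_apply]
  have hadd_right (u v z) : B z (u + v) = B z u + B z v := by
    simp [B, -AlternatingMap.curryLeft_apply_apply]
  have hsmul_left (c : ℝ) (u z) : B (c • u) z = c * B u z := by
    simp [B, -AlternatingMap.curryLeft_apply_apply]
  have hsmul_right (c : ℝ) (u z) : B z (c • u) = c * B z u := by
    simp [B, -AlternatingMap.curryLeft_apply_apply]
  have hsum_left (c : Fin K → ℝ) (z) : B (∑ i, c i • s i) z = 0 := by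
    let L : (Fin (K + 2) → ℝ) →ₗ[ℝ] ℝ :=
      { toFun := fun u => B u z
        map_add' := fun u v => hadd_left u v z
        map_smul' := fun c u => hsmul_left c u z }
    refine (map_sum L _ _).trans (Finset.sum_eq_zero fun i _ => ?_)
    rw [map_smul, show L (s i) = 0 from hleft i z, smul_zero]
  have hsum_right (c : Fin K → ℝ) (z) : B z (∑ i, c i • s i) = 0 := by
    let L : (Fin (K + 2) → ℝ) →ₗ[ℝ] ℝ :=
      { toFun := fun u => B z u
        map_add' := fun u v => hadd_right u v z
        map_smul' := fun c u => hsmul_right c u z }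
    refine (map_sum L _ _).trans (Finset.sum_eq_zero fun i _ => ?_)
    rw [map_smul, show L (s i) = 0 from hright i z, smul_zero]
  have hswap : B p x = - B x p := by
    have := hself (x + p)
    simp only [hadd_left, hadd_right, hself] at this
    linarith
  have hrep (y : Fin (K + 2) → ℝ) :
      ∃ (α β : ℝ) (c : Fin K → ℝ), y = α • x + β • p + ∑ i, c i • s i := by
    set M := of (vecCons x (vecCons p s)) with hM
    refine ⟨(y ᵥ* M⁻¹) 0, (y ᵥ* M⁻¹) 1, fun i => (y ᵥ* M⁻¹) i.succ.succ, ?_⟩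
    have h1 : (y ᵥ* M⁻¹) ᵥ* M = y := by
      rw [vecMul_vecMul, nonsing_inv_mul _ (isUnit_iff_ne_zero.mpr h), vecMul_one]
    conv_lhs => rw [← h1, vecMul_eq_sum, Fin.sum_univ_succ, Fin.sum_univ_succ, ← add_assoc]
    rfl
  obtain ⟨α, β, c, rfl⟩ := hrep a
  obtain ⟨γ, δ, e, rfl⟩ := hrep d
  simp only [hB, hadd_left, hadd_right, hsmul_left, hsmul_right, hsum_left, hsum_right, hself,
    hswap]
  ring

lemma det_vandermonde_vecCons_vecCons {K : ℕ} (y z : ℝ) (s : Fin K → ℝ) :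
    (vandermonde (vecCons y (vecCons z s))).det =
      (z - y) * (∏ i, (s i - y)) * (∏ i, (s i - z)) * (vandermonde s).det := by
  simp only [det_vandermonde, Fin.prod_univ_succ, Fin.prod_Ioi_zero, Fin.prod_Ioi_succ,
    cons_val_zero, cons_val_succ]
  ring

/-- The minor of the rows of `A` indexed by `α` has the sign of `ε` when these rows are listed
increasingly; the Vandermonde factor makes the condition independent of the listing. -/
def MinorPos {k : ℕ} (A : ℕ → Fin k → ℝ) (ε : ℝ) (α : Finset ℕ) : Prop :=
  ∀ f : Fin k → ℕ, Finset.univ.image f = α →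
    0 < (vandermonde fun i => (f i : ℝ)).det * (ε * (of fun i => A (f i)).det)

lemma minorPos_image {k : ℕ} {A : ℕ → Fin k → ℝ} {ε : ℝ} {f : Fin k → ℕ}
    (h : 0 < (vandermonde fun i => (f i : ℝ)).det * (ε * (of fun i => A (f i)).det)) :
    MinorPos A ε (Finset.univ.image f) := by
  have hfinj : Function.Injective f := by
    have := det_vandermonde_ne_zero_iff.mp (left_ne_zero_of_mul h.ne')
    exact fun i j hij => this (congrArg Nat.cast hij)
  intro g hg
  have hginj : Function.Injective g := by
    rw [← Set.injOn_univ, ← Finset.coe_univ, ← Finset.card_image_iff, hg,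
      Finset.card_image_of_injective _ hfinj]
  have hex (i) : ∃ j, f j = g i := by
    have : g i ∈ Finset.univ.image f := hg ▸ Finset.mem_image_of_mem g (Finset.mem_univ i)
    simpa using this
  choose σ hσ using hex
  have hσinj : Function.Injective σ := fun i j hij => hginj (by rw [← hσ i, ← hσ j, hij])
  let τ : Equiv.Perm (Fin k) := Equiv.ofBijective σ (Finite.injective_iff_bijective.mp hσinj)
  have hV : (vandermonde fun i => (g i : ℝ)) =
      (vandermonde fun i => (f i : ℝ)).submatrix τ id := by
    ext i j
    simp [vandermonde_apply, τ, hσ]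
  have hD : (of fun i => A (g i)) = (of fun i => A (f i)).submatrix τ id := by
    ext i j
    simp [τ, hσ]
  rw [hV, hD, det_permute, det_permute]
  rcases Int.units_eq_one_or (Equiv.Perm.sign τ) with hs | hs <;> rw [hs] <;> simpa using h

lemma det_vandermonde_pos_of_strictMono {k : ℕ} {f : Fin k → ℕ} (hf : StrictMono f) :
    0 < (vandermonde fun i => (f i : ℝ)).det := by
  rw [det_vandermonde]
  refine Finset.prod_pos fun i _ => Finset.prod_pos fun j hj => ?_
  have := hf (Finset.mem_Ioi.mp hj)
  simpa using this

lemma MinorPos.exchange {K : ℕ} {A : ℕ → Fin (K + 2) → ℝ} {ε : ℝ} {S : Finset ℕ}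
    (hS : S.card = K) {x a p d : ℕ} (hxa : x < a) (hap : a < p) (hpd : p < d)
    (h_xa : MinorPos A ε (insert x (insert a S))) (h_pd : MinorPos A ε (insert p (insert d S)))
    (h_xp : MinorPos A ε (insert x (insert p S))) (h_xd : MinorPos A ε (insert x (insert d S)))
    (h_ap : MinorPos A ε (insert a (insert p S))) :
    MinorPos A ε (insert a (insert d S)) := by
  let s : Fin K → ℕ := S.orderEmbOfFin hS
  have hs : Finset.univ.image s = S := S.image_orderEmbOfFin_univ hS
  let T (y z : ℕ) : Fin (K + 2) → ℕ := vecCons y (vecCons z s)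
  have hT (y z) : Finset.univ.image (T y z) = insert y (insert z S) := by
    rw [← hs]
    ext i
    simp [T, Fin.exists_fin_succ, eq_comm]
  let D (y z : ℕ) : ℝ := (of (vecCons (A y) (vecCons (A z) fun i => A (s i)))).det
  have hD (y z) : (of fun i => A (T y z i)).det = D y z := by
    congr 2
    ext i
    refine Fin.cases rfl (fun i => ?_) i
    exact Fin.cases rfl (fun i => rfl) i
  let w (y : ℕ) : ℝ := ∏ i, ((s i : ℝ) - y)
  let V : ℝ := (vandermonde fun i => (s i : ℝ)).det
  have hV (y z : ℕ) : (vandermonde fun i => (T y z i : ℝ)).det = (z - y) * w y * w z * V := by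
    rw [← det_vandermonde_vecCons_vecCons]
    congr 2
    ext i
    refine Fin.cases rfl (fun i => ?_) i
    exact Fin.cases rfl (fun i => rfl) i
  have key {y z : ℕ} (hyz : y < z) (h : MinorPos A ε (insert y (insert z S))) :
      0 < w y * w z * V * (ε * D y z) := by
    have h1 := h (T y z) (hT y z)
    rw [hV, hD] at h1
    have h2 : (0 : ℝ) < z - y := by simpa using hyz
    refine pos_of_mul_pos_right ?_ h2.le
    linarith
  have k_xa := key hxa h_xa
  have k_pd := key hpd h_pd
  have k_xp := key (hxa.trans hap) h_xp
  have k_xd := key (hxa.trans (hap.trans hpd)) h_xd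
  have k_ap := key hap h_ap
  have hne : D x p ≠ 0 := right_ne_zero_of_mul (right_ne_zero_of_mul k_xp.ne')
  have hpl : D x p * D a d = D x a * D p d + D x d * D a p :=
    det_vecCons_plucker (fun i => A (s i)) (A x) (A a) (A p) (A d) hne
  have k_ad : 0 < w a * w d * V * (ε * D a d) := by
    refine pos_of_mul_pos_right ?_ k_xp.le
    have : w x * w p * V * (ε * D x p) * (w a * w d * V * (ε * D a d)) =
        w x * w a * V * (ε * D x a) * (w p * w d * V * (ε * D p d)) +
        w x * w d * V * (ε * D x d) * (w a * w p * V * (ε * D a p)) := by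
      linear_combination (w x * w p * w a * w d * V ^ 2 * ε ^ 2) * hpl
    rw [this]
    positivity
  rw [← hT]
  refine minorPos_image ?_
  rw [hV, hD]
  have h2 : (0 : ℝ) < d - a := by simpa using hap.trans hpd
  have := mul_pos h2 k_ad
  linarith

/-- If all minors using the rows `0, …, j` are positive, then so are those using `0, …, j-1`, by
induction on the length `N` of an interval holding the remaining rows. -/
lemma minorPos_of_range_subset {n k : ℕ} (A : ℕ → Fin k → ℝ) (ε : ℝ)
    (H : ∀ j < k, ∀ a, j ≤ a → a + (k - j) ≤ n →
      0 < ε * (of fun i : Fin k => A (if (i : ℕ) < j then (i : ℕ) else a + (i - j))).det)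
    {j : ℕ} (hj : j < k)
    (ih : ∀ α : Finset ℕ, α.card = k → (∀ i ∈ α, i < n) → Finset.range (j + 1) ⊆ α →
      MinorPos A ε α)
    (N a : ℕ) (haj : j < a) (α : Finset ℕ) (hcard : α.card = k) (hαn : ∀ i ∈ α, i < n)
    (hjα : Finset.range j ⊆ α) (hα : ∀ i ∈ α, i < j ∨ a ≤ i ∧ i < a + N) :
    MinorPos A ε α := by
  induction N generalizing a α with
  | zero =>
    have : α ⊆ Finset.range j := fun i hi => by
      have := hα i hi
      simp only [Finset.mem_range]
      omega
    have := Finset.card_le_card this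
    simp only [Finset.card_range] at this
    omega
  | succ N ihN =>
    by_cases ha : a ∈ α
    swap
    · refine ihN (a + 1) (by omega) α hcard hαn hjα fun i hi => ?_
      have := hα i hi
      have : i ≠ a := fun h => ha (h ▸ hi)
      omega
    by_cases hd : a + N ∈ α
    swap
    · refine ihN a haj α hcard hαn hjα fun i hi => ?_
      have := hα i hi
      have : i ≠ a + N := fun h => hd (h ▸ hi)
      omega
    by_cases hfull : ∀ p, a < p → p < a + N → p ∈ α
    · have hset : α = Finset.range j ∪ Finset.Ico a (a + N + 1) := by
        ext i
        simp only [Finset.mem_union, Finset.mem_range, Finset.mem_Ico]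
        constructor
        · intro hi
          have := hα i hi
          omega
        · rintro (hi | ⟨h1, h2⟩)
          · exact hjα (Finset.mem_range.mpr hi)
          · rcases h1.eq_or_lt with rfl | h1
            · exact ha
            · rcases (Nat.lt_succ_iff.mp h2).eq_or_lt with rfl | h2
              · exact hd
              · exact hfull i h1 h2
      have hN : j + (N + 1) = k := by
        rw [← hcard, hset, Finset.card_union_of_disjoint, Finset.card_range, Nat.card_Ico]
        · omega
        · rw [Finset.disjoint_left]
          intro i
          simp only [Finset.mem_range, Finset.mem_Ico]
          omega
      let f : Fin k → ℕ := fun i => if (i : ℕ) < j then (i : ℕ) else a + (i - j)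
      have hf : StrictMono f := fun i i' hii => by
        have : (i : ℕ) < i' := hii
        simp only [f]
        split_ifs <;> omega
      have him : Finset.univ.image f = α := by
        refine Finset.eq_of_subset_of_card_le (fun i hi => ?_) ?_
        · obtain ⟨i, -, rfl⟩ := Finset.mem_image.mp hi
          have := i.isLt
          simp only [hset, f, Finset.mem_union, Finset.mem_range, Finset.mem_Ico]
          split_ifs <;> omega
        · rw [Finset.card_image_of_injective _ hf.injective]
          simp [hcard]
      rw [← him]
      refine minorPos_image (mul_pos (det_vandermonde_pos_of_strictMono hf) (H j hj a haj.le ?_))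
      have := hαn _ hd
      omega
    · push Not at hfull
      obtain ⟨p, hap, hpd, hp⟩ := hfull
      let S := (α.erase a).erase (a + N)
      have had : a + N ∈ α.erase a := Finset.mem_erase.mpr ⟨by omega, hd⟩
      have hαS : α = insert a (insert (a + N) S) := by
        rw [Finset.insert_erase had, Finset.insert_erase ha]
      have hScard : S.card + 2 = k := by
        have h1 : S.card + 1 = _ := Finset.card_erase_add_one had
        have h2 := Finset.card_erase_add_one ha
        omega
      have hxα : j ∉ α := fun h => by
        have := hα j h
        omega
      have hpn : p < n := by
        have := hαn _ hd
        omega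
      have hjn : j < n := by omega
      have hSmem (i) (hi : i ∈ S) : i ∈ α ∧ i ≠ a ∧ i ≠ a + N := by
        simp only [S, Finset.mem_erase] at hi
        tauto
      have hcard' (y z) (hyz : y ≠ z) (hy : y ∉ S) (hz : z ∉ S) :
          (insert y (insert z S)).card = k := by
        rw [Finset.card_insert_of_notMem (by simp [hyz, hy]), Finset.card_insert_of_notMem hz]
        omega
      have hlt (y z) (hy : y < n) (hz : z < n) : ∀ i ∈ insert y (insert z S), i < n := by
        intro i hi
        simp only [Finset.mem_insert] at hi
        rcases hi with rfl | rfl | hi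
        exacts [hy, hz, hαn i (hSmem i hi).1]
      have hrange (y z) : Finset.range j ⊆ insert y (insert z S) := by
        intro i hi
        have h1 := hjα hi
        have h2 := Finset.mem_range.mp hi
        simp only [Finset.mem_insert, S, Finset.mem_erase]
        refine Or.inr (Or.inr ⟨by omega, by omega, h1⟩)
      have haS : a ∉ S := fun h => (hSmem a h).2.1 rfl
      have hdS : a + N ∉ S := fun h => (hSmem _ h).2.2 rfl
      have hpS : p ∉ S := fun h => hp (hSmem p h).1
      have hjS : j ∉ S := fun h => hxα (hSmem j h).1
      have hj_pos (z) (hjz : j < z) (hz : z ∉ S) (hzn : z < n) :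
          MinorPos A ε (insert j (insert z S)) := by
        refine ih _ (hcard' j z hjz.ne hjS hz) (hlt j z hjn hzn) ?_
        rw [Finset.range_add_one]
        exact Finset.insert_subset (Finset.mem_insert_self _ _) (hrange j z)
      have h_pd : MinorPos A ε (insert p (insert (a + N) S)) := by
        refine ihN (a + 1) (by omega) _ (hcard' _ _ hpd.ne hpS hdS) (hlt _ _ hpn (hαn _ hd))
          (hrange _ _) fun i hi => ?_
        simp only [Finset.mem_insert] at hi
        rcases hi with rfl | rfl | hi
        · omega
        · omega
        · have h1 := hSmem i hi
          have h2 := hα i h1.1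
          omega
      have h_ap : MinorPos A ε (insert a (insert p S)) := by
        refine ihN a haj _ (hcard' _ _ hap.ne haS hpS) (hlt _ _ (hαn _ ha) hpn)
          (hrange _ _) fun i hi => ?_
        simp only [Finset.mem_insert] at hi
        rcases hi with rfl | rfl | hi
        · omega
        · omega
        · have h1 := hSmem i hi
          have h2 := hα i h1.1
          omega
      have h_xa := hj_pos a haj haS (hαn _ ha)
      have h_xp := hj_pos p (by omega) hpS hpn
      have h_xd := hj_pos (a + N) (by omega) hdS (hαn _ hd)
      rw [hαS]
      clear_value S
      subst hScard
      exact MinorPos.exchange rfl haj hap hpd h_xa h_pd h_xp h_xd h_ap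

/-- If the minors on the rows `{0, …, j-1} ∪ {a, …, a+k-j-1}` all have the sign of `ε`, so do
all `k × k` minors. -/
lemma minor_pos_of_initial_interval {n k : ℕ} (hk : 0 < k) (A : ℕ → Fin k → ℝ) (ε : ℝ)
    (H : ∀ j < k, ∀ a, j ≤ a → a + (k - j) ≤ n →
      0 < ε * (of fun i : Fin k => A (if (i : ℕ) < j then (i : ℕ) else a + (i - j))).det)
    (f : Fin k → ℕ) (hf : StrictMono f) (hfn : ∀ i, f i < n) :
    0 < ε * (of fun i => A (f i)).det := by
  have hkn : k ≤ n := by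
    have : Function.Injective fun i => (⟨f i, hfn i⟩ : Fin n) := fun i j hij =>
      hf.injective (congrArg Fin.val hij)
    simpa using Fintype.card_le_of_injective _ this
  have main (r : ℕ) : r ≤ k → ∀ α : Finset ℕ, α.card = k → (∀ i ∈ α, i < n) →
      Finset.range (k - r) ⊆ α → MinorPos A ε α := by
    induction r with
    | zero =>
      intro _ α hcard _ hα
      have hrange : Finset.univ.image (fun i : Fin k => (i : ℕ)) = α := by
        rw [← Finset.eq_of_subset_of_card_le hα (by simp [hcard])]
        ext i
        simp [Fin.exists_iff]
      rw [← hrange]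
      refine minorPos_image (mul_pos (det_vandermonde_pos_of_strictMono fun _ _ h => h) ?_)
      have h1 := H (k - 1) (by omega) (k - 1) le_rfl (by omega)
      have h2 (i : Fin k) :
          (if (i : ℕ) < k - 1 then (i : ℕ) else k - 1 + (i - (k - 1))) = i := by
        split_ifs <;> omega
      simpa only [h2] using h1
    | succ r ihr =>
      intro hr α hcard hαn hα
      have hstep : k - (r + 1) + 1 = k - r := by omega
      have ih := ihr (by omega)
      rw [← hstep] at ih
      by_cases hmem : k - (r + 1) ∈ α
      · refine ih α hcard hαn ?_
        rw [Finset.range_add_one]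
        exact Finset.insert_subset hmem hα
      · refine minorPos_of_range_subset A ε H (by omega) ih n (k - (r + 1) + 1) (by omega) α hcard hαn
          hα fun i hi => ?_
        have h1 := hαn i hi
        have h2 : i ≠ k - (r + 1) := fun h => hmem (h ▸ hi)
        omega
  have := main k le_rfl (Finset.univ.image f)
    (by rw [Finset.card_image_of_injective _ hf.injective]; simp) (by simpa using hfn) (by simp)
  exact pos_of_mul_pos_right (this f rfl) (det_vandermonde_pos_of_strictMono hf).le

/-- Matrix form of `minor_pos_of_initial_interval` for a fixed choice of columns. -/
lemma submatrix_minor_pos_of_initial_interval {n m k : ℕ} (hk : 0 < k)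
    (X : Matrix (Fin n) (Fin m) ℝ) (ε : ℝ) (g : Fin k → Fin m)
    (H : ∀ j < k, ∀ a, j ≤ a → a + (k - j) ≤ n → ∀ f : Fin k → Fin n,
      (∀ i, (f i : ℕ) = if (i : ℕ) < j then (i : ℕ) else a + (i - j)) →
      0 < ε * (X.submatrix f g).det)
    (f : Fin k → Fin n) (hf : StrictMono f) : 0 < ε * (X.submatrix f g).det := by
  let A : ℕ → Fin k → ℝ := fun i l => if h : i < n then X ⟨i, h⟩ (g l) else 0
  have hA (f : Fin k → Fin n) : (of fun i => A (f i)) = X.submatrix f g := by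
    ext i l
    simp [A]
  rw [← hA]
  refine minor_pos_of_initial_interval hk A ε (fun j hj a hja han => ?_) (fun i => f i) hf
    fun i => (f i).isLt
  have hlt (i : Fin k) : (if (i : ℕ) < j then (i : ℕ) else a + (i - j)) < n := by
    split_ifs <;> omega
  have := H j hj a hja han (fun i => ⟨_, hlt i⟩) fun i => rfl
  rwa [← hA] at this

/-- for `n > m`, `k ≤ m`, `X` is strictly `k`-sign consistent iff all the
staircase minors `det(X_{α,β})` share one strict sign. -/
theorem stmt16 {n m : ℕ} (X : Matrix (Fin n) (Fin m) ℝ) (k : ℕ)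
    (hnm : m < n) (hkm : k ≤ m) :
    SSC X k ↔
      ∃ ε : ℝ, (ε = 1 ∨ ε = -1) ∧
        ∀ r ∈ Finset.Icc 1 k, ∀ t ∈ Finset.Icc (k - r + 1) (n - r + 1),
        ∀ rb ∈ Finset.Icc 1 k, ∀ tb ∈ Finset.Icc (k - rb + 1) (m - rb + 1),
        ∀ (f : Fin k → Fin n) (g : Fin k → Fin m),
          (∀ i, (f i : ℕ) =
            if (i : ℕ) < k - r then (i : ℕ) else (i : ℕ) + t - 1 - (k - r)) →
          (∀ i, (g i : ℕ) =
            if (i : ℕ) < k - rb then (i : ℕ) else (i : ℕ) + tb - 1 - (k - rb)) →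
          0 < ε * (X.submatrix f g).det := by
  constructor
  · intro h
    have mono {N r t : ℕ} (hr : r ∈ Finset.Icc 1 k) (ht : t ∈ Finset.Icc (k - r + 1) (N - r + 1))
        (f : Fin k → Fin N) (hf : ∀ i, (f i : ℕ) =
          if (i : ℕ) < k - r then (i : ℕ) else (i : ℕ) + t - 1 - (k - r)) : StrictMono f := by
      intro i j hij
      rw [Finset.mem_Icc] at hr ht
      have h1 : (i : ℕ) < j := hij
      rw [Fin.lt_def, hf, hf]
      split_ifs <;> omega
    rcases h with h | h
    · refine ⟨1, Or.inl rfl, fun r hr t ht rb hrb tb htb f g hf hg => ?_⟩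
      simpa using h f g (mono hr ht f hf) (mono hrb htb g hg)
    · refine ⟨-1, Or.inr rfl, fun r hr t ht rb hrb tb htb f g hf hg => ?_⟩
      simpa using h f g (mono hr ht f hf) (mono hrb htb g hg)
  · rintro ⟨ε, hε, h⟩
    rcases Nat.eq_zero_or_pos k with rfl | hk
    · left
      intro f g _ _
      simp
    have key (f : Fin k → Fin n) (g : Fin k → Fin m) (hf : StrictMono f) (hg : StrictMono g) :
        0 < ε * (X.submatrix f g).det := by
      rw [← det_transpose, transpose_submatrix]
      refine submatrix_minor_pos_of_initial_interval hk Xᵀ ε f (fun j hj a ha ham g hg => ?_) g hg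
      rw [← det_transpose, transpose_submatrix, transpose_transpose]
      refine submatrix_minor_pos_of_initial_interval hk X ε g (fun j' hj' a' ha' han' f hf => ?_) f hf
      refine h (k - j') ?_ (a' + 1) ?_ (k - j) ?_ (a + 1) ?_ f g (fun i => ?_) (fun i => ?_)
      · rw [Finset.mem_Icc]; omega
      · rw [Finset.mem_Icc]; omega
      · rw [Finset.mem_Icc]; omega
      · rw [Finset.mem_Icc]; omega
      · rw [hf]; split_ifs <;> omega
      · rw [hg]; split_ifs <;> omega
    rcases hε with rfl | rfl
    · left
      simpa using key
    · right
      simpa using key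
end

section
/- Let X be a real n×m matrix with n > m. Then X is strictly m-sign consistent if and only if there exists ε ∈ {−1,+1} such that ε·det(X_{α,(1:m)}) > 0 for all α = {1,…,m−r} ∪ {t,…,t+r−1} with 1 ≤ r ≤ m and m−r+1 ≤ t ≤ n−r+1. -/
open Matrix Polynomial Filter

/-- Linear dependence of `m + 1` rows of an `m`-column matrix, with the coefficients given by
Cramer's rule. -/
theorem sum_mulVec_mul_det_succAbove {n m : ℕ} (X : Matrix (Fin n) (Fin m) ℝ)
    (e : Fin (m + 1) → Fin n) (u : Fin m → ℝ) :
    ∑ j : Fin (m + 1), (-1) ^ (j : ℕ) * (X *ᵥ u) (e j) *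
      (X.submatrix (e ∘ j.succAbove) id).det = 0 := by
  have hdet : (Matrix.of fun i : Fin (m + 1) =>
      (Fin.cons ((X *ᵥ u) (e i)) (X (e i)) : Fin (m + 1) → ℝ)).det = 0 := by
    refine Matrix.exists_mulVec_eq_zero_iff.mp ⟨Fin.cons (-1) u, fun h => ?_, ?_⟩
    · simpa using congrFun h 0
    · ext i
      simp [Matrix.mulVec, dotProduct, Fin.sum_univ_succ]
  rw [Matrix.det_succ_column_zero] at hdet
  exact hdet

theorem pos_of_exchange_relations {ε s α w β A B B' C P₀ P Pₘ : ℝ} (hs : s ≠ 0)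
    (r₁ : -1 * α * A + s * -1 * -1 * B = 0) (r₂ : s * -1 * B' + w * β * C = 0)
    (r₃ : α * P₀ + (s * -1 * P + w * β * Pₘ) = 0) (hA : 0 < ε * A) (hB : 0 < ε * B)
    (hB' : 0 < ε * B') (hC : 0 < ε * C) (hP₀ : 0 < ε * P₀) (hPₘ : 0 < ε * Pₘ) : 0 < ε * P := by
  have key : P * (A * C) = B * P₀ * C + B' * A * Pₘ := by
    refine mul_left_cancel₀ hs ?_
    linear_combination -(A * C) * r₃ - P₀ * C * r₁ + A * Pₘ * r₂
  have hprod : ε * P * (ε * A * (ε * C)) =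
      ε * B * (ε * P₀) * (ε * C) + ε * B' * (ε * A) * (ε * Pₘ) := by
    linear_combination ε ^ 3 * key
  have hpos : 0 < ε * P * (ε * A * (ε * C)) := by rw [hprod]; positivity
  exact (pos_iff_pos_of_mul_pos hpos).mpr (mul_pos hA hC)

/-- If all maximal minors using row `0` have the sign of `ε`, then among the maximal minors
obtained by deleting one of `m + 2` rows, the positivity of the two extreme ones implies that of
the intermediate ones. -/
theorem det_succAbove_pos_of_extreme {n m : ℕ} (X : Matrix (Fin (n + 1)) (Fin (m + 1)) ℝ) (ε : ℝ)
    (hX : ∀ f : Fin (m + 1) → Fin (n + 1), StrictMono f → f 0 = 0 →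
      0 < ε * (X.submatrix f id).det)
    (e : Fin (m + 2) → Fin (n + 1)) (he : StrictMono e) (he0 : 0 < e 0)
    (hfirst : 0 < ε * (X.submatrix (e ∘ Fin.succ) id).det)
    (hlast : 0 < ε * (X.submatrix (e ∘ Fin.castSucc) id).det) (i : Fin m) :
    0 < ε * (X.submatrix (e ∘ i.succ.castSucc.succAbove) id).det := by
  have hpos : ∀ j, 0 < e j := fun j => he0.trans_le (he.monotone (Fin.zero_le j))
  have hXdel : ∀ (g : Fin (m + 1) → Fin (n + 1)) (j : Fin (m + 1)), StrictMono g →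
      (∀ k, 0 < g k) → 0 < ε * (X.submatrix
        ((Fin.cons 0 g : Fin (m + 2) → Fin (n + 1)) ∘ j.succ.succAbove) id).det := by
    intro g j hg h0
    refine hX _ ((Fin.strictMono_cons.mpr ⟨h0, hg⟩).comp (Fin.strictMono_succAbove _)) ?_
    simp
  obtain ⟨u, hu⟩ : ∃ u, X.submatrix
      (Fin.cons 0 (fun k : Fin m => e k.succ.castSucc) : Fin (m + 1) → Fin (n + 1)) id *ᵥ u =
      Pi.single i.succ 1 := by
    have hdet := hX _ (Fin.strictMono_cons.mpr
      ⟨fun k : Fin m => hpos k.succ.castSucc, fun a b hab => he (by simpa using hab)⟩) rfl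
    have hunit := isUnit_iff_ne_zero.mpr (right_ne_zero_of_mul hdet.ne')
    exact ⟨(X.submatrix _ id)⁻¹ *ᵥ Pi.single i.succ 1, by
      rw [Matrix.mulVec_mulVec, Matrix.mul_nonsing_inv _ hunit, Matrix.one_mulVec]⟩
  have hu0 : (X *ᵥ u) 0 = 0 := by
    simpa [Matrix.mulVec, dotProduct] using congrFun hu 0
  have hui : ∀ k : Fin m, (X *ᵥ u) (e k.succ.castSucc) = if k = i then 1 else 0 := fun k => by
    simpa [Matrix.mulVec, dotProduct, Pi.single_apply] using congrFun hu k.succ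
  have r1 := sum_mulVec_mul_det_succAbove X (Fin.cons 0 (e ∘ Fin.castSucc)) u
  have r2 := sum_mulVec_mul_det_succAbove X (Fin.cons 0 (e ∘ Fin.succ)) u
  have r3 := sum_mulVec_mul_det_succAbove X e u
  have p1 := hXdel (e ∘ Fin.castSucc) 0 (he.comp Fin.strictMono_castSucc) fun k => hpos _
  have p1' := hXdel (e ∘ Fin.castSucc) i.succ (he.comp Fin.strictMono_castSucc) fun k => hpos _
  have p2 := hXdel (e ∘ Fin.succ) (Fin.last m) (he.comp Fin.strictMono_succ) fun k => hpos _
  have p2' := hXdel (e ∘ Fin.succ) i.castSucc (he.comp Fin.strictMono_succ) fun k => hpos _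
  rw [Fin.sum_univ_succ, Fin.sum_univ_succ] at r1
  rw [Fin.sum_univ_succ, Fin.sum_univ_castSucc] at r2
  rw [Fin.sum_univ_succ, Fin.sum_univ_castSucc] at r3
  have hui' : ∀ k : Fin m, (X *ᵥ u) (e k.castSucc.succ) = if k = i then 1 else 0 := hui
  simp only [Fin.cons_zero, Fin.cons_succ, Function.comp_apply, hu0, Fin.succ_castSucc, hui,
    mul_ite, mul_one, mul_zero, ite_mul, zero_mul, Finset.sum_ite_eq', Finset.mem_univ, if_true,
    Fin.castSucc_zero, zero_add, Fin.val_succ, Fin.val_castSucc, Fin.val_zero, Fin.val_last,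
    pow_zero, one_mul,    pow_succ] at r1 r3
  simp only [Fin.cons_zero, Fin.cons_succ, Function.comp_apply, hu0, hui',
    mul_ite, mul_one, mul_zero, ite_mul, zero_mul, Finset.sum_ite_eq', Finset.mem_univ, if_true,
    zero_add, Fin.val_succ, Fin.val_castSucc, Fin.val_last, pow_succ] at r2
  rw [← Fin.succAbove_zero] at hfirst
  rw [← Fin.succAbove_last] at hlast
  exact pos_of_exchange_relations (pow_ne_zero _ (by norm_num)) r1 r2 r3 p1 p1' p2' p2 hfirst hlast

theorem strictMono_insertNth_of_gap {n m : ℕ} {f : Fin (m + 1) → Fin n} (hf : StrictMono f)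
    (i : Fin m) {c : Fin n} (hl : f i.castSucc < c) (hr : c < f i.succ) :
    StrictMono (Fin.insertNth i.succ.castSucc c f : Fin (m + 2) → Fin n) := by
  refine (Fin.strictMono_insertNth_iff _ _ _).mpr ⟨hf, fun j hj => ?_, fun j hj => ?_⟩
  · exact (hf.monotone (by simpa using hj)).trans_lt hl
  · exact hr.trans_le (hf.monotone (Fin.castSucc_lt_iff_succ_le.mp (by simpa using hj)))

/-- If the minors on rows `0, …, k - 1` followed by a block of consecutive rows have the sign of
`ε`, then so do all maximal minors. -/
theorem det_pos_of_staircase {m : ℕ} : ∀ {n : ℕ} (X : Matrix (Fin n) (Fin m) ℝ) (ε : ℝ),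
    (∀ (k s : ℕ) (f : Fin m → Fin n), (∀ i, (f i : ℕ) = if (i : ℕ) < k then (i : ℕ) else i + s) →
      0 < ε * (X.submatrix f id).det) →
    ∀ f : Fin m → Fin n, StrictMono f → 0 < ε * (X.submatrix f id).det := by
  induction m with
  | zero => exact fun X ε h f _ => h 0 0 f fun i => i.elim0
  | succ m ih =>
    intro n X ε h f hf
    have hmn : m + 1 ≤ n := by simpa using Fintype.card_le_of_injective f hf.injective
    obtain ⟨n, rfl⟩ : ∃ k, n = k + 1 := ⟨n - 1, by omega⟩
    have hzero : ∀ f : Fin (m + 1) → Fin (n + 1), StrictMono f → f 0 = 0 →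
        0 < ε * (X.submatrix f id).det := by
      set T := X.submatrix (Fin.castLE hmn) id
      have hTdet : 0 < ε * T.det := h 0 0 _ fun i => by simp
      have hT0 : T.det ≠ 0 := right_ne_zero_of_mul hTdet.ne'
      have hrow : ∀ j, (X * T⁻¹) 0 j = (1 : Matrix (Fin (m + 1)) (Fin (m + 1)) ℝ) 0 j := by
        intro j
        rw [← Matrix.mul_nonsing_inv T (isUnit_iff_ne_zero.mpr hT0)]
        rfl
      have hminor : ∀ g : Fin m → Fin n,
          (X.submatrix (Fin.cons 0 (Fin.succ ∘ g) : Fin (m + 1) → Fin (n + 1)) id).det =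
            T.det * (((X * T⁻¹).submatrix Fin.succ Fin.succ).submatrix g id).det := by
        intro g
        have hmul : X.submatrix (Fin.cons 0 (Fin.succ ∘ g) : Fin (m + 1) → Fin (n + 1)) id =
            (X * T⁻¹).submatrix (Fin.cons 0 (Fin.succ ∘ g)) id * T := by
          conv_lhs => rw [← Matrix.mul_one X, ← Matrix.nonsing_inv_mul T
            (isUnit_iff_ne_zero.mpr hT0), ← Matrix.mul_assoc]
          rfl
        rw [hmul, Matrix.det_mul, mul_comm]
        congr 1
        rw [Matrix.det_succ_row_zero, Fin.sum_univ_succ]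
        simp [hrow, Matrix.submatrix_submatrix, Function.comp_def,
          (Fin.succ_ne_zero _).symm]
      intro f hf hf0
      have hfpos : ∀ i : Fin m, f i.succ ≠ 0 := fun i => by
        rw [← hf0]; exact hf.injective.ne (Fin.succ_ne_zero i)
      have hfcons : f = Fin.cons 0 (Fin.succ ∘ fun i => (f i.succ).pred (hfpos i)) := by
        ext i
        induction i using Fin.cases <;> simp [hf0]
      rw [hfcons, hminor, ← mul_assoc]
      refine ih _ _ (fun k s g hg => ?_) _ fun a b hab => by simpa using hf (by simpa using hab)
      rw [mul_assoc, ← hminor]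
      refine h (k + 1) s _ fun i => ?_
      induction i using Fin.cases with
      | zero => simp
      | succ i =>
        simp only [Fin.cons_succ, Function.comp_apply, Fin.val_succ, hg]
        split_ifs <;> omega
    induction hd : (f (Fin.last m) : ℕ) - f 0 using Nat.strong_induction_on generalizing f with
    | _ d ihd =>
      subst hd
      by_cases hgap : ∃ i : Fin m, (f i.castSucc : ℕ) + 1 < f i.succ
      · obtain ⟨i, hi⟩ := hgap
        obtain ⟨e, he, rfl⟩ : ∃ e : Fin (m + 2) → Fin (n + 1), StrictMono e ∧
            e ∘ i.succ.castSucc.succAbove = f :=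
          ⟨_, strictMono_insertNth_of_gap hf i (c := ⟨f i.castSucc + 1, hi.trans (f i.succ).isLt⟩)
            (Fin.lt_def.mpr (Nat.lt_succ_self _)) (Fin.lt_def.mpr hi), by ext; simp⟩
        have hfirst : i.succ.castSucc.succAbove 0 = 0 :=
          Fin.succAbove_ne_zero_zero (by simp)
        have hlast : i.succ.castSucc.succAbove (Fin.last m) = Fin.last (m + 1) :=
          Fin.succAbove_ne_last_last (by simp [Fin.ext_iff]; omega)
        by_cases h0 : e 0 = 0
        · exact hzero _ hf (by simpa [hfirst] using h0)
        have h01 : (e 0 : ℕ) < e (Fin.succ 0) := he (Fin.succ_pos 0)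
        have h1l : (e (Fin.last m).castSucc : ℕ) < e (Fin.last (m + 1)) :=
          he (Fin.castSucc_lt_last _)
        have h0l : (e 0 : ℕ) < e (Fin.last (m + 1)) := he (Fin.succ_pos (Fin.last m))
        refine det_succAbove_pos_of_extreme X ε hzero e he (Fin.pos_iff_ne_zero.mpr h0) ?_ ?_ i
        · refine ihd _ ?_ _ (he.comp Fin.strictMono_succ) rfl
          simp only [Function.comp_apply, hfirst, hlast]
          change (e (Fin.last (m + 1)) : ℕ) - e (Fin.succ 0) < _
          omega
        · refine ihd _ ?_ _ (he.comp Fin.strictMono_castSucc) rfl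
          simp only [Function.comp_apply, hfirst, hlast, Fin.castSucc_zero]
          omega
      · push Not at hgap
        refine h 0 (f 0) f fun j => ?_
        simp only [not_lt_zero, if_false]
        induction j using Fin.induction with
        | zero => simp
        | succ j ih =>
          have := Fin.lt_def.mp (hf (Fin.castSucc_lt_succ (i := j)))
          have := hgap j
          simp only [Fin.val_castSucc, Fin.val_succ] at ih ⊢
          omega

/-- for `n > m`, `X` is strictly `m`-sign consistent iff all the staircase
minors `det(X_{α,(1:m)})` share one strict sign. -/
theorem stmt17 {n m : ℕ} (X : Matrix (Fin n) (Fin m) ℝ) (hnm : m < n) :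
    SSC X m ↔
      ∃ ε : ℝ, (ε = 1 ∨ ε = -1) ∧
        ∀ r ∈ Finset.Icc 1 m, ∀ t ∈ Finset.Icc (m - r + 1) (n - r + 1),
        ∀ f : Fin m → Fin n,
          (∀ i, (f i : ℕ) =
            if (i : ℕ) < m - r then (i : ℕ) else (i : ℕ) + t - 1 - (m - r)) →
          0 < ε * (X.submatrix f id).det := by
  constructor
  · intro h
    have hstair : ∀ r ∈ Finset.Icc 1 m, ∀ t ∈ Finset.Icc (m - r + 1) (n - r + 1),
        ∀ f : Fin m → Fin n, (∀ i, (f i : ℕ) =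
          if (i : ℕ) < m - r then (i : ℕ) else (i : ℕ) + t - 1 - (m - r)) → StrictMono f := by
      intro r hr t ht f hf a b hab
      have := hf a
      have := hf b
      rw [Finset.mem_Icc] at hr ht
      rw [Fin.lt_def] at hab ⊢
      split_ifs at * <;> omega
    rcases h with h | h
    · refine ⟨1, Or.inl rfl, fun r hr t ht f hf => ?_⟩
      simpa using h f id (hstair r hr t ht f hf) strictMono_id
    · refine ⟨-1, Or.inr rfl, fun r hr t ht f hf => ?_⟩
      simpa using h f id (hstair r hr t ht f hf) strictMono_id
  · rintro ⟨ε, hε, h⟩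
    rcases m.eq_zero_or_pos with rfl | hm
    · exact Or.inl fun f g _ _ => by simp
    have hpos := det_pos_of_staircase X ε fun k s f hf => by
      have hlast := hf ⟨m - 1, by omega⟩
      have hlt := (f ⟨m - 1, by omega⟩).isLt
      by_cases hk : k < m
      · rw [if_neg (by simp; omega)] at hlast
        simp only at hlast
        refine h (m - k) (Finset.mem_Icc.mpr (by omega)) (s + k + 1)
          (Finset.mem_Icc.mpr (by omega)) f fun i => ?_
        rw [hf i]
        split_ifs <;> omega
      · refine h 1 (Finset.mem_Icc.mpr (by omega)) m (Finset.mem_Icc.mpr (by omega)) f fun i => ?_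
        have := i.isLt
        rw [hf i]
        split_ifs <;> omega
    rcases hε with rfl | rfl
    · refine Or.inl fun f g hf hg => ?_
      rw [hg.eq_id]
      simpa using hpos f hf
    · refine Or.inr fun f g hf hg => ?_
      rw [hg.eq_id]
      simpa using hpos f hf
end
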